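/- Let G be a bipartite finite simple graph on [n] without isolated vertices and I(G) its edge ideal in S = k[x_1,…,x_n]. Then S/I(G)^{(2)} is Cohen-Macaulay if and only if G is a disjoint union of edges (i.e., a perfect matching; equivalently, I(G) is a complete intersection). -/

import Mathlib

open MvPolynomial CategoryTheory CategoryTheory.Limits

noncomputable section

/-- A simplicial complex on a vertex set `V`: a collection of finite subsets of `V`
closed under taking subsets. -/
def IsSimplicialComplex {V : Type} (Δ : Set (Finset V)) : Prop :=
  ∀ F ∈ Δ, ∀ G : Finset V, G ⊆ F → G ∈ Δ

/-- The dimension of a simplicial complex: `max {|F| - 1 : F ∈ Δ}`. -/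
def complexDim {V : Type} (Δ : Set (Finset V)) : ℤ :=
  sSup ((fun F : Finset V => (F.card : ℤ) - 1) '' Δ)

/-- The star of a face: `st_Δ(F) = {H ∈ Δ : H ∪ F ∈ Δ}`. -/
def complexStar {V : Type} [DecidableEq V] (Δ : Set (Finset V)) (F : Finset V) :
    Set (Finset V) :=
  {H | H ∈ Δ ∧ H ∪ F ∈ Δ}

/-- The facets (maximal faces) of a simplicial complex. -/
def facets {V : Type} (Δ : Set (Finset V)) : Set (Finset V) :=
  {F | F ∈ Δ ∧ ∀ G ∈ Δ, F ⊆ G → F = G}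

/-- The Stanley–Reisner ideal of a simplicial complex `Δ`:
generated by the squarefree monomials `∏_{i ∈ F} x_i` with `F ∉ Δ`. -/
def srIdeal (k : Type) [Field k] {V : Type} (Δ : Set (Finset V)) :
    Ideal (MvPolynomial V k) :=
  Ideal.span {m | ∃ F : Finset V, F ∉ Δ ∧ m = ∏ i ∈ F, X i}

/-- The face prime `P_F = (x_j : j ∉ F)`. -/
def facePrime (k : Type) [Field k] {V : Type} (F : Finset V) :
    Ideal (MvPolynomial V k) :=
  Ideal.span ((X : V → MvPolynomial V k) '' {j | j ∉ F})

/-- The `m`-th symbolic power of the Stanley–Reisner ideal: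
`I_Δ^{(m)} = ⋂_{F facet of Δ} P_F^m`. -/
def symbolicPower (k : Type) [Field k] {V : Type} (Δ : Set (Finset V)) (m : ℕ) :
    Ideal (MvPolynomial V k) :=
  ⨅ F ∈ facets Δ, (facePrime k F) ^ m

/-- The homogeneous maximal ideal `m = (x_1, …, x_n)` of the polynomial ring. -/
def maxIdeal (k : Type) [Field k] (V : Type) : Ideal (MvPolynomial V k) :=
  Ideal.span (Set.range (X : V → MvPolynomial V k))

/-- The `i`-th local cohomology module `H^i_m(S/I)`. -/
def locCoh (k : Type) [Field k] (V : Type) (I : Ideal (MvPolynomial V k)) (i : ℕ) :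
    ModuleCat (MvPolynomial V k) :=
  (localCohomology (maxIdeal k V) i).obj
    (ModuleCat.of (MvPolynomial V k) (MvPolynomial V k ⧸ I))

/-- `S/I` is Cohen–Macaulay: `H^i_m(S/I) = 0` for all `i < dim S/I`. -/
def quotCM (k : Type) [Field k] (V : Type) (I : Ideal (MvPolynomial V k)) : Prop :=
  ∀ i : ℕ, (i : WithBot (WithTop ℕ)) < ringKrullDim (MvPolynomial V k ⧸ I) →
    Subsingleton (locCoh k V I i)

/-- `S/I` is generalized Cohen–Macaulay: `H^i_m(S/I)` has finite length for all
`i < dim S/I`. -/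
def quotGCM (k : Type) [Field k] (V : Type) (I : Ideal (MvPolynomial V k)) : Prop :=
  ∀ i : ℕ, (i : WithBot (WithTop ℕ)) < ringKrullDim (MvPolynomial V k ⧸ I) →
    IsFiniteLength (MvPolynomial V k) (locCoh k V I i)

/-- `S/I` is `r`-Buchsbaum: `m^r · H^i_m(S/I) = 0` for all `i < dim S/I`. -/
def quotKBuchsbaum (k : Type) [Field k] (V : Type) (I : Ideal (MvPolynomial V k))
    (r : ℕ) : Prop :=
  ∀ i : ℕ, (i : WithBot (WithTop ℕ)) < ringKrullDim (MvPolynomial V k ⧸ I) →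
    ∀ x ∈ (maxIdeal k V) ^ r, ∀ y : locCoh k V I i, x • y = 0

/-- The canonical map `Ext^i_S(S/m, S/I) → H^i_m(S/I)`, realized as the colimit
injection at the first power of `m` in the direct system defining local cohomology. -/
def canonicalExtToLocCoh (k : Type) [Field k] (V : Type) (I : Ideal (MvPolynomial V k))
    (i : ℕ) :
    ((localCohomology.diagram (localCohomology.idealPowersDiagram (maxIdeal k V)) i).obj
        (Opposite.op (Opposite.op (1 : ℕ)))).obj
      (ModuleCat.of (MvPolynomial V k) (MvPolynomial V k ⧸ I)) ⟶ locCoh k V I i :=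
  letI := localCohomology.hasColimitDiagram.{0,0}
    (localCohomology.idealPowersDiagram (maxIdeal k V)) i
  (colimit.ι (localCohomology.diagram (localCohomology.idealPowersDiagram (maxIdeal k V)) i)
    (Opposite.op (Opposite.op (1 : ℕ)))).app (ModuleCat.of (MvPolynomial V k) (MvPolynomial V k ⧸ I))

/-- `S/I` is Buchsbaum: the canonical map `Ext^i_S(S/m, S/I) → H^i_m(S/I)` is
surjective for all `i < dim S/I`. -/
def quotBuchsbaum (k : Type) [Field k] (V : Type) (I : Ideal (MvPolynomial V k)) : Prop :=
  ∀ i : ℕ, (i : WithBot (WithTop ℕ)) < ringKrullDim (MvPolynomial V k ⧸ I) →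
    Function.Surjective (canonicalExtToLocCoh k V I i)

/-- A simplicial complex is Cohen–Macaulay if its Stanley–Reisner ring is
Cohen–Macaulay over every field. -/
def complexCM {V : Type} (Δ : Set (Finset V)) : Prop :=
  ∀ (k : Type) [Field k], quotCM k V (srIdeal k Δ)

/-- A simplicial complex is Buchsbaum if its Stanley–Reisner ring is Buchsbaum over
every field. -/
def complexBuchsbaum {V : Type} (Δ : Set (Finset V)) : Prop :=
  ∀ (k : Type) [Field k], quotBuchsbaum k V (srIdeal k Δ)

/-- The independence complex of a graph: faces are the independent sets. -/
def indepComplex {V : Type} (G : SimpleGraph V) : Set (Finset V) :=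
  {F | ∀ i ∈ F, ∀ j ∈ F, ¬ G.Adj i j}

/-- The edge ideal `I(G) = (x_i x_j : ij ∈ E(G))`. -/
def edgeIdeal (k : Type) [Field k] {V : Type} (G : SimpleGraph V) :
    Ideal (MvPolynomial V k) :=
  Ideal.span {m | ∃ i j : V, G.Adj i j ∧ m = X i * X j}

/-- The independence number `α(G)`. -/
def indepNumber {V : Type} (G : SimpleGraph V) : ℕ :=
  sSup {c | ∃ F ∈ indepComplex G, F.card = c}

/-- A graph is Cohen–Macaulay if its independence complex is. -/
def graphCM {V : Type} (G : SimpleGraph V) : Prop :=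
  complexCM (indepComplex G)

/-- The vertex set of the localization `G_{pq} = G \ (N(p) ∪ N(q))` of `G` at an
edge `pq`. -/
def edgeLocSet {V : Type} (G : SimpleGraph V) (p q : V) : Set V :=
  {v | v ∉ G.neighborSet p ∪ G.neighborSet q}

/-- The localization of `G` at an edge `pq`: the induced subgraph on the vertices not
adjacent to `p` or `q` (this removes `p` and `q` as well). -/
def edgeLoc {V : Type} (G : SimpleGraph V) (p q : V) :
    SimpleGraph (edgeLocSet G p q) :=
  G.induce (edgeLocSet G p q)

/-- `G` is special Cohen–Macaulay: `G` is Cohen–Macaulay and for every edge `pq`,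
`G_{pq}` is Cohen–Macaulay with `α(G_{pq}) = α(G) - 1`. -/
def specialCM {V : Type} (G : SimpleGraph V) : Prop :=
  graphCM G ∧ ∀ p q : V, G.Adj p q →
    graphCM (edgeLoc G p q) ∧ indepNumber (edgeLoc G p q) + 1 = indepNumber G

/-- The vertex set of `G_i = G \ ({i} ∪ N(i))`. -/
def vertexLocSet {V : Type} (G : SimpleGraph V) (i : V) : Set V :=
  {v | v ≠ i ∧ v ∉ G.neighborSet i}

/-- `G_i = G \ ({i} ∪ N(i))`: the induced subgraph obtained by deleting `i` and all
its neighbors. -/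
def vertexLoc {V : Type} (G : SimpleGraph V) (i : V) :
    SimpleGraph (vertexLocSet G i) :=
  G.induce (vertexLocSet G i)

/-- A graph is unmixed if all its maximal independent sets have the same cardinality. -/
def graphUnmixed {V : Type} (G : SimpleGraph V) : Prop :=
  ∀ F ∈ facets (indepComplex G), ∀ F' ∈ facets (indepComplex G), F.card = F'.card

/-- `G` has no isolated vertices. -/
def noIsolated {V : Type} (G : SimpleGraph V) : Prop :=
  ∀ v : V, ∃ w : V, G.Adj v w

end

section LocalCohomology
open Opposite

namespace CategoryTheory.ShortComplex

lemma mono_homologyMap_of_forall {R : Type} [Ring R] {S T : ShortComplex (ModuleCat.{0} R)}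
    (ψ : S ⟶ T)
    (h : ∀ x : S.X₂, S.g x = 0 → (∃ y, T.f y = ψ.τ₂ x) → ∃ y, S.f y = x) :
    Mono (homologyMap ψ) := by
  rw [ModuleCat.mono_iff_injective, injective_iff_map_eq_zero]
  intro c hc
  obtain ⟨z, rfl⟩ := (ModuleCat.epi_iff_surjective S.homologyπ).1 inferInstance c
  have hz : T.homologyπ (cyclesMap ψ z) = 0 := by
    rw [← ModuleCat.comp_apply, ← homologyπ_naturality]; exact hc
  have hex : (ShortComplex.mk T.toCycles T.homologyπ (by simp)).Exact :=
    ShortComplex.exact_of_g_is_cokernel _ T.homologyIsCokernel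
  obtain ⟨y, hy⟩ := (ShortComplex.moduleCat_exact_iff _).1 hex _ hz
  obtain ⟨w, hw⟩ := h (S.iCycles z) (by rw [← ModuleCat.comp_apply]; simp)
    ⟨y, by
      have := congrArg T.iCycles hy
      dsimp only at this
      rw [← ModuleCat.comp_apply, ← ModuleCat.comp_apply] at this
      simpa using this⟩
  have : S.toCycles w = z := by
    apply (ModuleCat.mono_iff_injective S.iCycles).1 inferInstance
    rw [← ModuleCat.comp_apply, toCycles_i, hw]
  rw [← this, ← ModuleCat.comp_apply]; simp

end CategoryTheory.ShortComplex

section ExtComparison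
variable {R : Type} [CommRing R]

/-- The augmentation of a projective resolution. -/
noncomputable def augmentation {X : ModuleCat.{0} R} (P : ProjectiveResolution X) :
    P.complex.X 0 ⟶ X :=
  P.π.f 0

instance {X : ModuleCat.{0} R} (P : ProjectiveResolution X) : Epi (augmentation P) :=
  inferInstanceAs (Epi (P.π.f 0))

lemma d_comp_augmentation {X : ModuleCat.{0} R} (P : ProjectiveResolution X) :
    P.complex.d 1 0 ≫ augmentation P = 0 := P.complex_d_comp_π_f_zero

lemma exists_augmentation_comp_eq {X Y : ModuleCat.{0} R} (P : ProjectiveResolution X)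
    (x : P.complex.X 0 ⟶ Y) (hx : P.complex.d 1 0 ≫ x = 0) : ∃ g : X ⟶ Y, augmentation P ≫ g = x :=
  ⟨P.exact₀.desc x hx, P.exact₀.g_desc x hx⟩

lemma subsingleton_ext_obj_iff (n : ℕ) (X Y : ModuleCat.{0} R) :
    Subsingleton (((Ext R (ModuleCat.{0} R) n).obj (op X)).obj Y) ↔
      Subsingleton (Abelian.Ext X Y n) := by
  let P := projectiveResolution X
  rw [← ModuleCat.isZero_iff_subsingleton, (P.isoExt n Y).isZero_iff,
    ← HomologicalComplex.exactAt_iff_isZero_homology]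
  cases n with
  | zero =>
    rw [HomologicalComplex.exactAt_iff' _ 0 0 1 (by simp) (by simp),
      ShortComplex.moduleCat_exact_iff]
    rw [Abelian.Ext.addEquiv₀.subsingleton_congr]
    constructor
    · intro h
      refine subsingleton_of_forall_eq 0 fun g => ?_
      have h0 : P.complex.d 1 0 ≫ augmentation P ≫ g = 0 := by
        rw [← Category.assoc, d_comp_augmentation, zero_comp]
      obtain ⟨y, h1⟩ : ∃ y : P.complex.X 0 ⟶ Y, P.complex.d 0 0 ≫ y = augmentation P ≫ g :=
        h (augmentation P ≫ g) h0
      rw [P.complex.shape _ _ (by simp), zero_comp] at h1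
      rw [← cancel_epi (augmentation P), ← h1, comp_zero]
    · intro h x hx
      obtain ⟨g, hg⟩ := exists_augmentation_comp_eq P (x : P.complex.X 0 ⟶ Y) hx
      have h1 : P.complex.d 0 0 ≫ (0 : P.complex.X 0 ⟶ Y) = x := by
        rw [comp_zero, ← hg, Subsingleton.elim g 0, comp_zero]
      exact ⟨_, h1⟩
  | succ n =>
    rw [HomologicalComplex.exactAt_iff' _ n (n + 1) (n + 2) (by simp) (by simp),
      ShortComplex.moduleCat_exact_iff]
    constructor
    · intro h
      refine subsingleton_of_forall_eq 0 fun g => ?_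
      obtain ⟨f, hf, rfl⟩ := P.extMk_surjective g (n + 2) rfl
      exact (P.extMk_eq_zero_iff f _ rfl hf n rfl).2 (h f hf)
    · intro h x hx
      exact (P.extMk_eq_zero_iff x _ rfl hx n rfl).1 (Subsingleton.elim _ _)

/-- The map on `Hom(-, Y)` induced by a chain map between projective resolutions. -/
noncomputable def linearYonedaObjMap {X X' : ModuleCat.{0} R} (P : ProjectiveResolution X)
    (P' : ProjectiveResolution X') (φ : P.complex ⟶ P'.complex) (Y : ModuleCat.{0} R) :
    P'.complex.linearYonedaObj R Y ⟶ P.complex.linearYonedaObj R Y :=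
  (HomologicalComplex.unopFunctor _ _).map
    ((((linearYoneda R (ModuleCat.{0} R)).obj Y).rightOp.mapHomologicalComplex _).map φ).op

lemma comp_inv_comm_of_comm {C : Type*} [Category C] {a b c d e g : C} {p : a ⟶ b} {q : b ⟶ c}
    {r : a ⟶ d} {s : d ⟶ c} {u : e ≅ d} {t : e ⟶ g} {v : g ≅ c}
    (h : p ≫ q = r ≫ s) (h' : u.hom ≫ s = t ≫ v.hom) :
    p ≫ q ≫ v.inv = (r ≫ u.inv) ≫ t := by
  rw [reassoc_of% h, Category.assoc, show s = u.inv ≫ t ≫ v.hom by rw [← h', Iso.inv_hom_id_assoc]]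
  simp

lemma ext_map_app_comp_isoExt_hom {X X' : ModuleCat.{0} R} (f : X ⟶ X')
    (P : ProjectiveResolution X) (P' : ProjectiveResolution X') (φ : P.complex ⟶ P'.complex)
    (comm : φ.f 0 ≫ augmentation P' = augmentation P ≫ f) (Y : ModuleCat.{0} R) (n : ℕ) :
    ((Ext R (ModuleCat.{0} R) n).map f.op).app Y ≫ (P.isoExt n Y).hom =
      (P'.isoExt n Y).hom ≫ HomologicalComplex.homologyMap (linearYonedaObjMap P P' φ Y) n := by
  let F := ((linearYoneda R (ModuleCat.{0} R)).obj Y).rightOp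
  have h1 := ProjectiveResolution.isoLeftDerivedObj_inv_naturality f P P' φ comm F n
  have h2 := HomologicalComplex.homologyOp_hom_naturality (linearYonedaObjMap P P' φ Y) n
  have h1' : ((Ext R (ModuleCat.{0} R) n).map f.op).app Y ≫ (P.isoLeftDerivedObj F n).inv.unop =
      (P'.isoLeftDerivedObj F n).inv.unop ≫
        (HomologicalComplex.homologyMap ((F.mapHomologicalComplex _).map φ) n).unop :=
    congrArg Quiver.Hom.unop h1
  have h2' : (HomologicalComplex.homologyUnop ((F.mapHomologicalComplex _).obj P'.complex) n).hom ≫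
        (HomologicalComplex.homologyMap ((F.mapHomologicalComplex _).map φ) n).unop =
      HomologicalComplex.homologyMap (linearYonedaObjMap P P' φ Y) n ≫
        (HomologicalComplex.homologyUnop ((F.mapHomologicalComplex _).obj P.complex) n).hom :=
    congrArg Quiver.Hom.unop h2
  have e1 : (P.isoExt n Y).hom = (P.isoLeftDerivedObj F n).inv.unop ≫
      (HomologicalComplex.homologyUnop ((F.mapHomologicalComplex _).obj P.complex) n).inv := rfl
  have e2 : (P'.isoExt n Y).hom = (P'.isoLeftDerivedObj F n).inv.unop ≫
      (HomologicalComplex.homologyUnop ((F.mapHomologicalComplex _).obj P'.complex) n).inv := rfl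
  rw [e1, e2]
  exact comp_inv_comm_of_comm h1' h2'

lemma mono_ext_map_app {X X' : ModuleCat.{0} R} (f : X ⟶ X') [Epi f] (Y : ModuleCat.{0} R) (n : ℕ)
    (h : ∀ x : Abelian.Ext X' Y n, (Abelian.Ext.mk₀ f).comp x (zero_add n) = 0 → x = 0) :
    Mono (((Ext R (ModuleCat.{0} R) n).map f.op).app Y) := by
  let P := projectiveResolution X
  let P' := projectiveResolution X'
  let φ := ProjectiveResolution.lift f P P'
  have comm : φ.f 0 ≫ augmentation P' = augmentation P ≫ f :=
    ProjectiveResolution.lift_commutes_zero f P P'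
  suffices Mono (HomologicalComplex.homologyMap (linearYonedaObjMap P P' φ Y) n) by
    have e := ext_map_app_comp_isoExt_hom f P P' φ comm Y n
    rw [← Iso.eq_comp_inv] at e
    rw [e]
    infer_instance
  apply ShortComplex.mono_homologyMap_of_forall
  change ∀ x : P'.complex.X n ⟶ Y, P'.complex.d ((ComplexShape.up ℕ).next n) n ≫ x = 0 →
    (∃ y : P.complex.X ((ComplexShape.up ℕ).prev n) ⟶ Y, P.complex.d n _ ≫ y = φ.f n ≫ x) →
    ∃ y : P'.complex.X ((ComplexShape.up ℕ).prev n) ⟶ Y, P'.complex.d n _ ≫ y = x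
  rw [CochainComplex.next]
  rintro x hx ⟨y, hy⟩
  cases n with
  | zero =>
    obtain ⟨g, rfl⟩ := exists_augmentation_comp_eq P' x hx
    refine ⟨0, ?_⟩
    rw [comp_zero]
    rw [reassoc_of% comm, P.complex.shape _ _ (by simp), zero_comp] at hy
    have : g = 0 := by
      rw [← cancel_epi f, ← cancel_epi (augmentation P), ← hy]; simp
    rw [this, comp_zero]
  | succ n =>
    generalize hp : (ComplexShape.up ℕ).prev (n+1) = p at *
    rw [CochainComplex.prev_nat_succ] at hp
    subst hp
    refine (P'.extMk_eq_zero_iff x (n + 2) rfl hx n rfl).1 (h _ ?_)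
    have comm' : φ.f 0 ≫ P'.π.f 0 = P.π.f 0 ≫ ((ChainComplex.single₀ _).map f).f 0 := comm
    rw [ProjectiveResolution.mk₀_comp_extMk (R' := P) x _ rfl hx (φ := ⟨φ, comm'⟩)]
    exact (P.extMk_eq_zero_iff _ (n + 2) rfl _ n rfl).2 ⟨y, hy⟩

lemma support_subset_zeroLocus_of_pow_smul_eq_zero {J : Ideal R} {N : Type} [AddCommGroup N]
    [Module R N] (t : ℕ) (h : ∀ r ∈ J ^ t, ∀ x : N, r • x = 0) :
    Module.support R N ⊆ PrimeSpectrum.zeroLocus J := by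
  intro p hp
  rw [Module.mem_support_iff_exists_annihilator] at hp
  obtain ⟨x, hx⟩ := hp
  have : J ^ t ≤ p.asIdeal := fun r hr => hx (by
    rw [Submodule.mem_annihilator_span_singleton]; exact h r hr x)
  exact (PrimeSpectrum.mem_zeroLocus _ _).2 (p.2.le_of_pow_le this)

lemma subsingleton_ext_of_pow_smul_eq_zero [IsNoetherianRing R] {J : Ideal R} {n : ℕ}
    {M : ModuleCat.{0} R} [Module.Finite R M] (hM : J • (⊤ : Submodule R M) < ⊤)
    (h : ∀ i < n, Subsingleton (Abelian.Ext (ModuleCat.of R (R ⧸ J)) M i))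
    (N : ModuleCat.{0} R) [Module.Finite R N] (t : ℕ) (ht : ∀ r ∈ J ^ t, ∀ x : N, r • x = 0) :
    ∀ i < n, Subsingleton (Abelian.Ext N M i) := by
  rcases subsingleton_or_nontrivial N with hN | hN
  · intro i _
    have : IsZero N := ModuleCat.isZero_of_subsingleton N
    refine subsingleton_of_forall_eq 0 fun x => ?_
    rw [← Abelian.Ext.mk₀_id_comp x, this.eq_of_src (𝟙 N) 0, Abelian.Ext.mk₀_zero,
      Abelian.Ext.zero_comp]
  · have key := ((ModuleCat.exists_isRegular_tfae J n M hM).out 2 0).1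
    refine key ⟨ModuleCat.of R (R ⧸ J), ?_, inferInstanceAs (Module.Finite R (R ⧸ J)), ?_, h⟩ N hN
      inferInstance (support_subset_zeroLocus_of_pow_smul_eq_zero t ht)
    · apply Submodule.Quotient.nontrivial_iff.mpr
      rintro rfl
      simp at hM
    · change Module.support R (R ⧸ J) = _
      rw [Module.support_eq_zeroLocus, Ideal.annihilator_quotient]

lemma ext_eq_zero_of_mk₀_comp_eq_zero [IsNoetherianRing R] {J : Ideal R} {n : ℕ}
    {M : ModuleCat.{0} R} [Module.Finite R M] (hM : J • (⊤ : Submodule R M) < ⊤)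
    (h : ∀ i < n, Subsingleton (Abelian.Ext (ModuleCat.of R (R ⧸ J)) M i))
    {X X' : ModuleCat.{0} R} [Module.Finite R X] (f : X ⟶ X') [Epi f] (t : ℕ)
    (ht : ∀ r ∈ J ^ t, ∀ x : X, r • x = 0) (x : Abelian.Ext X' M n)
    (hx : (Abelian.Ext.mk₀ f).comp x (zero_add n) = 0) : x = 0 := by
  cases n with
  | zero => exact Abelian.Ext.precomp_mk₀_injective_of_epi M f (hx.trans (by simp))
  | succ n =>
    have hS := LinearMap.shortExact_shortComplexKer ((ModuleCat.epi_iff_surjective f).1 ‹_›)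
    obtain ⟨y, rfl⟩ := Abelian.Ext.contravariant_sequence_exact₃ hS M x hx (add_comm 1 n)
    have := subsingleton_ext_of_pow_smul_eq_zero hM h (ModuleCat.of R (LinearMap.ker f.hom)) t
      (fun r hr x => Subtype.ext (ht r hr x.1)) n (Nat.lt_succ_self n)
    rw [show y = 0 from @Subsingleton.elim _ this _ _, Abelian.Ext.comp_zero]

lemma subsingleton_localCohomology_iff [IsNoetherianRing R] {J : Ideal R} (n : ℕ)
    {M : ModuleCat.{0} R} [Module.Finite R M] (hM : J • (⊤ : Submodule R M) < ⊤) :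
    (∀ i < n, Subsingleton ((localCohomology J i).obj M)) ↔
      ∀ i < n, Subsingleton (Abelian.Ext (ModuleCat.of R (R ⧸ J)) M i) := by
  have hkill : ∀ t : ℕ, ∀ r ∈ J ^ t, ∀ x : ModuleCat.of R (R ⧸ J ^ t), r • x = 0 := by
    intro t r hr x
    have : r ∈ Module.annihilator R (R ⧸ J ^ t) := by rwa [Ideal.annihilator_quotient]
    exact Module.mem_annihilator.1 this x
  let D := fun i => localCohomology.diagram.{0, 0} (localCohomology.idealPowersDiagram J) i
  have hcol : ∀ i, ∃ c : Cocone (D i ⋙ (evaluation _ _).obj M),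
      Nonempty (IsColimit c) ∧ c.pt = (localCohomology J i).obj M := fun i => by
    have := localCohomology.hasColimitDiagram.{0, 0} (localCohomology.idealPowersDiagram J) i
    exact ⟨_, ⟨isColimitOfPreserves ((evaluation _ _).obj M) (colimit.isColimit (D i))⟩, rfl⟩
  constructor
  · intro h i
    induction i using Nat.strong_induction_on with
    | _ i ih =>
    intro hi
    obtain ⟨c, ⟨hc⟩, hpt⟩ := hcol i
    have hmono : ∀ (j j' : (ℕᵒᵖ)ᵒᵖ) (φ : j ⟶ j'), Mono ((D i ⋙ (evaluation _ _).obj M).map φ) := by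
      intro j j' φ
      let f := (localCohomology.ringModIdeals (localCohomology.idealPowersDiagram J)).map φ.unop
      have : Epi f := (ModuleCat.epi_iff_surjective f).2 (by
        intro x
        obtain ⟨x, rfl⟩ := Submodule.Quotient.mk_surjective _ x
        exact ⟨Submodule.Quotient.mk x, rfl⟩)
      have : Module.Finite R ((localCohomology.ringModIdeals
        (localCohomology.idealPowersDiagram J)).obj j'.unop) :=
        inferInstanceAs (Module.Finite R (R ⧸ J ^ _))
      exact mono_ext_map_app f M i (ext_eq_zero_of_mk₀_comp_eq_zero hM
        (fun l hl => ih l hl (hl.trans hi)) f j'.unop.unop (hkill _))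
    have := hc.mono_ι_app_of_isFiltered (op (op 1))
    have h0 : IsZero c.pt := by
      rw [hpt, ModuleCat.isZero_iff_subsingleton]; exact h i hi
    have h1 := (ModuleCat.isZero_iff_subsingleton).1 (IsZero.of_mono (c.ι.app (op (op 1))) h0)
    have h2 : Subsingleton
        (((Ext R (ModuleCat.{0} R) i).obj (op (ModuleCat.of R (R ⧸ J ^ 1)))).obj M) := h1
    rwa [subsingleton_ext_obj_iff, pow_one] at h2
  · intro h i hi
    obtain ⟨c, ⟨hc⟩, hpt⟩ := hcol i
    rw [← hpt, ← ModuleCat.isZero_iff_subsingleton, IsZero.iff_id_eq_zero]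
    refine hc.hom_ext fun j => ?_
    apply IsZero.eq_of_src
    rw [ModuleCat.isZero_iff_subsingleton]
    change Subsingleton
      (((Ext R (ModuleCat.{0} R) i).obj (op (ModuleCat.of R (R ⧸ J ^ j.unop.unop)))).obj M)
    rw [subsingleton_ext_obj_iff]
    exact subsingleton_ext_of_pow_smul_eq_zero hM h (ModuleCat.of R (R ⧸ J ^ j.unop.unop))
      j.unop.unop (hkill _) i hi

end ExtComparison

end LocalCohomology

section Colon
variable {R : Type} [CommRing R] (I I' I'' : Ideal R) (a : R)

/-- Multiplication by `a` as a map `R/(I : a) → R/I`. -/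
noncomputable def colonMap (h : ∀ b, b ∈ I' ↔ a * b ∈ I) :
    ModuleCat.of R (R ⧸ I') ⟶ ModuleCat.of R (R ⧸ I) :=
  ModuleCat.ofHom (Submodule.mapQ I' I (LinearMap.mulLeft R a) (fun b hb => (h b).1 hb))

/-- The complex `R/(I : a) → R/I → R/(I + (a))`. -/
noncomputable def colonComplex (h : ∀ b, b ∈ I' ↔ a * b ∈ I) (h' : I'' = I ⊔ Ideal.span {a}) :
    ShortComplex (ModuleCat.{0} R) where
  f := colonMap I I' a h
  g := ModuleCat.ofHom (Submodule.mapQ I I'' LinearMap.id (by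
    rw [h']; exact le_sup_left))
  zero := by
    refine ModuleCat.hom_ext (LinearMap.ext fun x => ?_)
    obtain ⟨x, rfl⟩ := Submodule.Quotient.mk_surjective _ x
    refine (Submodule.Quotient.mk_eq_zero _).2 ?_
    rw [h']
    exact Ideal.mul_mem_right _ _ (Ideal.mem_sup_right (Ideal.mem_span_singleton_self a))

lemma colonComplex_shortExact (h : ∀ b, b ∈ I' ↔ a * b ∈ I) (h' : I'' = I ⊔ Ideal.span {a}) :
    (colonComplex I I' I'' a h h').ShortExact := by
  apply ModuleCat.shortComplex_shortExact
  · intro x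
    obtain ⟨x, rfl⟩ := Submodule.Quotient.mk_surjective _ x
    constructor
    · intro hx
      have hx' : x ∈ I'' := (Submodule.Quotient.mk_eq_zero _).1 hx
      rw [h', Submodule.mem_sup] at hx'
      obtain ⟨y, hy, z, hz, rfl⟩ := hx'
      obtain ⟨b, rfl⟩ := Ideal.mem_span_singleton'.1 hz
      refine ⟨Submodule.Quotient.mk b, (Submodule.Quotient.eq _).2 ?_⟩
      change a * b - (y + b * a) ∈ I
      have : a * b - (y + b * a) = -y := by ring
      rw [this]; exact neg_mem hy
    · rintro ⟨b, hb⟩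
      rw [← hb]
      obtain ⟨b, rfl⟩ := Submodule.Quotient.mk_surjective _ b
      exact congrArg (fun f => f.hom (Submodule.Quotient.mk b)) (colonComplex I I' I'' a h h').zero
  · rw [injective_iff_map_eq_zero]
    intro x hx
    obtain ⟨x, rfl⟩ := Submodule.Quotient.mk_surjective _ x
    exact (Submodule.Quotient.mk_eq_zero _).2 ((h x).2 ((Submodule.Quotient.mk_eq_zero _).1 hx))
  · intro x
    obtain ⟨x, rfl⟩ := Submodule.Quotient.mk_surjective _ x
    exact ⟨Submodule.Quotient.mk x, rfl⟩

lemma colonMap_self (h : ∀ b, b ∈ I ↔ a * b ∈ I) : colonMap I I a h = a • 𝟙 _ := by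
  refine ModuleCat.hom_ext (LinearMap.ext fun x => ?_)
  obtain ⟨x, rfl⟩ := Submodule.Quotient.mk_surjective _ x
  rfl

variable {I I' I'' a}

lemma exists_colonMap_comp_eq (h : ∀ b, b ∈ I' ↔ a * b ∈ I) (h' : I'' = I ⊔ Ideal.span {a})
    (Y : ModuleCat.{0} R) (n : ℕ) (r : R)
    (hr : ∀ z : Abelian.Ext (ModuleCat.of R (R ⧸ I'')) Y (n + 1), r • z = 0)
    (x : Abelian.Ext (ModuleCat.of R (R ⧸ I')) Y n) :
    ∃ y : Abelian.Ext (ModuleCat.of R (R ⧸ I)) Y n,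
      (Abelian.Ext.mk₀ (colonMap I I' a h)).comp y (zero_add n) = r • x := by
  have hS := colonComplex_shortExact I I' I'' a h h'
  let δ : Abelian.Ext (ModuleCat.of R (R ⧸ I'')) (ModuleCat.of R (R ⧸ I')) 1 := hS.extClass
  have h1 : δ.comp (r • x) (add_comm 1 n) = 0 := by
    rw [Abelian.Ext.comp_smul]; exact hr _
  exact Abelian.Ext.contravariant_sequence_exact₁ hS Y (r • x) _ h1

lemma comp_colonMap_injective (h : ∀ b, b ∈ I' ↔ a * b ∈ I) (h' : I'' = I ⊔ Ideal.span {a})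
    (Y : ModuleCat.{0} R) (n : ℕ)
    (hY : ∀ j < n, Subsingleton (Abelian.Ext Y (ModuleCat.of R (R ⧸ I'')) j))
    (x : Abelian.Ext Y (ModuleCat.of R (R ⧸ I')) n)
    (hx : x.comp (Abelian.Ext.mk₀ (colonMap I I' a h)) (add_zero n) = 0) : x = 0 := by
  have hS := colonComplex_shortExact I I' I'' a h h'
  cases n with
  | zero =>
    have : Mono (colonMap I I' a h) := hS.mono_f
    exact Abelian.Ext.postcomp_mk₀_injective_of_mono Y (colonMap I I' a h)
      (hx.trans (by simp))
  | succ n =>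
    obtain ⟨y, rfl⟩ := Abelian.Ext.covariant_sequence_exact₁ Y hS x hx rfl
    have := hY n (Nat.lt_succ_self n)
    rw [show y = 0 from @Subsingleton.elim _ this _ _]
    apply Abelian.Ext.zero_comp

lemma subsingleton_ext_quotient_of_colon (h : ∀ b, b ∈ I' ↔ a * b ∈ I)
    (h' : I'' = I ⊔ Ideal.span {a}) (Y : ModuleCat.{0} R) (n : ℕ)
    (h1 : Subsingleton (Abelian.Ext Y (ModuleCat.of R (R ⧸ I')) n))
    (h2 : Subsingleton (Abelian.Ext Y (ModuleCat.of R (R ⧸ I'')) n)) :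
    Subsingleton (Abelian.Ext Y (ModuleCat.of R (R ⧸ I)) n) := by
  have hS := colonComplex_shortExact I I' I'' a h h'
  refine subsingleton_of_forall_eq 0 fun x => ?_
  obtain ⟨y, hy⟩ := Abelian.Ext.covariant_sequence_exact₂ Y hS x (@Subsingleton.elim _ h2 _ _)
  rw [← hy, show y = 0 from @Subsingleton.elim _ h1 _ _]
  apply Abelian.Ext.zero_comp

end Colon

section FacePrime
variable {k : Type} [Field k] {V : Type}

lemma mem_facePrime {F : Finset V} {x : MvPolynomial V k} :
    x ∈ facePrime k F ↔ ∀ m ∈ x.support, ∃ i, i ∉ F ∧ m i ≠ 0 :=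
  mem_ideal_span_X_image

lemma mem_facePrime_iff_X_mul {F : Finset V} {w : V} (hw : w ∈ F) (b : MvPolynomial V k) :
    b ∈ facePrime k F ↔ X w * b ∈ facePrime k F := by
  classical
  refine ⟨fun h => Ideal.mul_mem_left _ _ h, fun h => mem_facePrime.2 fun m hm => ?_⟩
  obtain ⟨i, hi, hi'⟩ := mem_facePrime.1 h (Finsupp.single w 1 + m) (by
    rw [mem_support_iff, coeff_X_mul]; exact mem_support_iff.1 hm)
  refine ⟨i, hi, ?_⟩
  have : w ≠ i := fun e => hi (e ▸ hw)
  simpa [Finsupp.single_apply, this] using hi'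

lemma facePrime_erase [DecidableEq V] {F : Finset V} {w : V} (hw : w ∉ F) :
    facePrime k F = facePrime k (insert w F) ⊔ Ideal.span {X w} := by
  have : {j | j ∉ F} = {j | j ∉ insert w F} ∪ {w} := by
    ext j
    by_cases h : j = w
    · simp [h, hw]
    · simp [h]
  rw [facePrime, this, Set.image_union, Ideal.span_union, Set.image_singleton, facePrime]

lemma facePrime_empty : facePrime k (∅ : Finset V) = maxIdeal k V := by
  simp [facePrime, maxIdeal]

/-- A version of Ischebeck's theorem at the origin: if `Ext^j(k, M)` vanishes below `d`, then
`Ext^j(S/P_W, M)` vanishes at the origin for `j + |W| < d`. -/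
lemma exists_smul_ext_facePrime_eq_zero [Finite V] {M : ModuleCat.{0} (MvPolynomial V k)}
    [Module.Finite (MvPolynomial V k) M] {d : ℕ}
    (hM : ∀ j < d, Subsingleton (Abelian.Ext (ModuleCat.of (MvPolynomial V k)
      (MvPolynomial V k ⧸ maxIdeal k V)) M j)) (W : Finset V) (j : ℕ) (hj : j + W.card < d) :
    ∃ r : MvPolynomial V k, r - 1 ∈ maxIdeal k V ∧
      ∀ x : Abelian.Ext (ModuleCat.of (MvPolynomial V k)
        (MvPolynomial V k ⧸ facePrime k W)) M j, r • x = 0 := by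
  classical
  induction W using Finset.induction generalizing j with
  | empty =>
    refine ⟨1, by simp, fun x => ?_⟩
    have := hM j (by simpa using hj)
    rw [← facePrime_empty] at this
    exact Subsingleton.elim _ _
  | insert w W hw ih =>
    rw [Finset.card_insert_of_notMem hw] at hj
    obtain ⟨r, hr, hr'⟩ := ih (j + 1) (by omega)
    let N := ModuleCat.of (MvPolynomial V k) (MvPolynomial V k ⧸ facePrime k (insert w W))
    have : Module.Finite (MvPolynomial V k) N :=
      inferInstanceAs
        (Module.Finite (MvPolynomial V k) (MvPolynomial V k ⧸ facePrime k (insert w W)))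
    have hcol := mem_facePrime_iff_X_mul (k := k) (Finset.mem_insert_self w W)
    obtain ⟨s, hs, hs'⟩ := Submodule.exists_sub_one_mem_and_smul_eq_zero_of_fg_of_le_smul
      (maxIdeal k V) (⊤ : Submodule (MvPolynomial V k) (Abelian.Ext N M j))
      Module.Finite.fg_top (by
        intro x _
        obtain ⟨y, hy⟩ := exists_colonMap_comp_eq hcol (facePrime_erase (k := k) hw) M j r hr' x
        have hy' : (X w : MvPolynomial V k) • y = r • x := by
          rw [← hy, colonMap_self, Abelian.Ext.mk₀_smul, Abelian.Ext.smul_comp,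
            Abelian.Ext.mk₀_id_comp]
        have : x = (X w : MvPolynomial V k) • y - (r - 1) • x := by
          rw [hy', sub_smul, one_smul, sub_sub_cancel]
        rw [this]
        exact sub_mem (Submodule.smul_mem_smul (Ideal.subset_span ⟨w, rfl⟩) trivial)
          (Submodule.smul_mem_smul hr trivial))
    exact ⟨s, hs, fun x => hs' x trivial⟩

end FacePrime

section Weight
variable {k : Type} [Field k] {V : Type} [Fintype V] [DecidableEq V]

/-- The degree of a monomial in the variables outside `F`. -/
def outDegree (F : Finset V) (m : V →₀ ℕ) : ℕ := ∑ i ∈ Fᶜ, m i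

lemma outDegree_add (F : Finset V) (m m' : V →₀ ℕ) :
    outDegree F (m + m') = outDegree F m + outDegree F m' := by
  simp [outDegree, Finset.sum_add_distrib]

lemma outDegree_mono (F : Finset V) {m m' : V →₀ ℕ} (h : m ≤ m') :
    outDegree F m ≤ outDegree F m' :=
  Finset.sum_le_sum fun i _ => h i

lemma outDegree_single (F : Finset V) (i : V) (c : ℕ) :
    outDegree F (Finsupp.single i c) = if i ∈ F then 0 else c := by
  simp [outDegree, Finsupp.single_apply]

lemma one_le_outDegree_iff {F : Finset V} {m : V →₀ ℕ} :
    1 ≤ outDegree F m ↔ ∃ i, i ∉ F ∧ m i ≠ 0 := by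
  simp [Nat.one_le_iff_ne_zero, outDegree]

omit [Fintype V] [DecidableEq V] in
lemma X_mem_facePrime {F : Finset V} {i : V} (hi : i ∉ F) :
    (X i : MvPolynomial V k) ∈ facePrime k F :=
  Ideal.subset_span ⟨i, hi, rfl⟩

lemma monomial_mem_facePrime_pow (F : Finset V) (m : V →₀ ℕ) (c : k) :
    monomial m c ∈ facePrime k F ^ outDegree F m := by
  rw [monomial_eq, Finsupp.prod_fintype _ _ (by simp), ← Finset.prod_compl_mul_prod F,
    outDegree, ← Finset.prod_pow_eq_pow_sum]
  refine Ideal.mul_mem_left _ _ (Ideal.mul_mem_right _ _ (Ideal.prod_mem_prod fun i hi => ?_))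
  exact Ideal.pow_mem_pow (X_mem_facePrime (Finset.mem_compl.1 hi)) _

lemma mem_facePrime_sq {F : Finset V} {x : MvPolynomial V k} :
    x ∈ facePrime k F ^ 2 ↔ ∀ m ∈ x.support, 2 ≤ outDegree F m := by
  constructor
  · intro hx
    rw [pow_two] at hx
    refine Submodule.mul_induction_on hx (fun a ha b hb m hm => ?_) (fun a b ha hb m hm => ?_)
    · obtain ⟨m₁, h₁, m₂, h₂, rfl⟩ := Finset.mem_add.1 (support_mul a b hm)
      have := one_le_outDegree_iff.2 (mem_facePrime.1 ha _ h₁)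
      have := one_le_outDegree_iff.2 (mem_facePrime.1 hb _ h₂)
      rw [outDegree_add]
      omega
    · exact (Finset.mem_union.1 (support_add hm)).elim (ha m) (hb m)
  · intro h
    rw [x.as_sum]
    exact sum_mem fun m hm => Ideal.pow_le_pow_right (h m hm) (monomial_mem_facePrime_pow F m _)

lemma coeff_eq_zero_of_mem_facePrime_sq {F : Finset V} {x : MvPolynomial V k}
    (hx : x ∈ facePrime k F ^ 2) {m : V →₀ ℕ} (hm : outDegree F m < 2) : coeff m x = 0 := by
  by_contra h
  exact absurd (mem_facePrime_sq.1 hx m (mem_support_iff.2 h)) (by omega)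

lemma monomial_mem_facePrime_sq {F : Finset V} {m : V →₀ ℕ} (c : k) (hm : 2 ≤ outDegree F m) :
    monomial m c ∈ facePrime k F ^ 2 :=
  Ideal.pow_le_pow_right hm (monomial_mem_facePrime_pow F m c)

omit [Fintype V] [DecidableEq V] in
lemma mem_symbolicPower {Δ : Set (Finset V)} {t : ℕ} {x : MvPolynomial V k} :
    x ∈ symbolicPower k Δ t ↔ ∀ F ∈ facets Δ, x ∈ facePrime k F ^ t := by
  simp [symbolicPower, Submodule.mem_iInf]

omit [Fintype V] [DecidableEq V] in
lemma mem_maxIdeal {x : MvPolynomial V k} : x ∈ maxIdeal k V ↔ coeff 0 x = 0 := by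
  rw [← facePrime_empty, mem_facePrime]
  constructor
  · intro h
    by_contra h0
    obtain ⟨i, _, hi⟩ := h 0 (mem_support_iff.2 h0)
    exact hi rfl
  · intro h m hm
    have : m ≠ 0 := by rintro rfl; exact mem_support_iff.1 hm h
    obtain ⟨i, hi⟩ := Finsupp.ne_iff.1 this
    exact ⟨i, by simp, hi⟩

omit [Fintype V] [DecidableEq V] in
lemma symbolicPower_two_le {Δ : Set (Finset V)} {F : Finset V} (hF : F ∈ facets Δ) :
    symbolicPower k Δ 2 ≤ facePrime k F := fun _ hx =>
  Ideal.pow_le_self two_ne_zero (mem_symbolicPower.1 hx F hF)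

omit [Fintype V] [DecidableEq V] in
lemma facePrime_le_maxIdeal (F : Finset V) : facePrime k F ≤ maxIdeal k V :=
  Ideal.span_mono (Set.image_subset_range _ _)

omit [Fintype V] [DecidableEq V] in
lemma maxIdeal_smul_top_lt {I : Ideal (MvPolynomial V k)} (hI : I ≤ maxIdeal k V) :
    maxIdeal k V • (⊤ : Submodule (MvPolynomial V k) (MvPolynomial V k ⧸ I)) < ⊤ := by
  rw [lt_top_iff_ne_top]
  intro h
  have h1 : (Submodule.Quotient.mk 1 : MvPolynomial V k ⧸ I) ∈
      maxIdeal k V • (⊤ : Submodule (MvPolynomial V k) (MvPolynomial V k ⧸ I)) := by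
    rw [h]; exact Submodule.mem_top
  have h2 : maxIdeal k V • (⊤ : Submodule (MvPolynomial V k) (MvPolynomial V k ⧸ I)) ≤
      Submodule.map I.mkQ (maxIdeal k V) := by
    refine Submodule.smul_le.2 fun r hr y _ => ?_
    obtain ⟨y, rfl⟩ := Submodule.Quotient.mk_surjective _ y
    exact ⟨r * y, Ideal.mul_mem_right _ _ hr, rfl⟩
  obtain ⟨y, hy, hy'⟩ := h2 h1
  have h3 : (1 : MvPolynomial V k) ∈ maxIdeal k V := by
    have := hI ((Submodule.Quotient.eq I).1 hy')
    simpa using sub_mem hy this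
  rw [mem_maxIdeal] at h3
  simp at h3

lemma card_le_ringKrullDim {I : Ideal (MvPolynomial V k)} {F : Finset V}
    (hI : I ≤ facePrime k F) : (F.card : WithBot ℕ∞) ≤ ringKrullDim (MvPolynomial V k ⧸ I) := by
  let f : MvPolynomial V k →ₐ[k] MvPolynomial F k :=
    aeval fun i => if h : i ∈ F then X ⟨i, h⟩ else 0
  have hf : ∀ x ∈ I, f x = 0 := by
    intro x hx
    have : facePrime k F ≤ RingHom.ker f := Ideal.span_le.2 (by
      rintro _ ⟨i, hi, rfl⟩
      have hi' : i ∉ F := hi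
      simp [f, hi'])
    exact this (hI hx)
  have hsurj : Function.Surjective f := by
    rw [← AlgHom.range_eq_top, eq_top_iff, ← adjoin_range_X, Algebra.adjoin_le_iff]
    rintro _ ⟨i, rfl⟩
    exact ⟨X i, by simp [f]⟩
  have := ringKrullDim_le_of_surjective (Ideal.Quotient.lift I f.toRingHom hf)
    (Ideal.Quotient.lift_surjective_of_surjective _ _ hsurj)
  rw [MvPolynomial.ringKrullDim_of_isNoetherianRing] at this
  simpa using this

omit [DecidableEq V] in
lemma exists_facet {Δ : Set (Finset V)} {H : Finset V} (hH : H ∈ Δ) :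
    ∃ F ∈ facets Δ, H ⊆ F := by
  obtain ⟨F, hHF, hF⟩ := (Set.toFinite Δ).exists_le_maximal hH
  exact ⟨F, ⟨hF.1, fun G hG h => le_antisymm h (hF.2 hG h)⟩, hHF⟩

lemma quotCM.subsingleton_ext {I : Ideal (MvPolynomial V k)} (hI : quotCM k V I) {F : Finset V}
    (hF : I ≤ facePrime k F) (j : ℕ) (hj : j < F.card) :
    Subsingleton (Abelian.Ext (ModuleCat.of (MvPolynomial V k) (MvPolynomial V k ⧸ maxIdeal k V))
      (ModuleCat.of (MvPolynomial V k) (MvPolynomial V k ⧸ I)) j) := by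
  have : Module.Finite (MvPolynomial V k)
      (ModuleCat.of (MvPolynomial V k) (MvPolynomial V k ⧸ I)) :=
    inferInstanceAs (Module.Finite (MvPolynomial V k) (MvPolynomial V k ⧸ I))
  refine (subsingleton_localCohomology_iff F.card
    (maxIdeal_smul_top_lt (hF.trans (facePrime_le_maxIdeal F)))).1 (fun i hi => ?_) j hj
  refine hI i (lt_of_lt_of_le ?_ (card_le_ringKrullDim hF))
  change ((i : ℕ) : WithBot ℕ∞) < (F.card : WithBot ℕ∞)
  exact_mod_cast hi

end Weight

section Forward
variable {k : Type} [Field k] {V : Type}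

lemma exists_mul_mem_of_ext [Finite V] {I : Ideal (MvPolynomial V k)} {d : ℕ}
    (hI : ∀ j < d, Subsingleton (Abelian.Ext
      (ModuleCat.of (MvPolynomial V k) (MvPolynomial V k ⧸ maxIdeal k V))
      (ModuleCat.of (MvPolynomial V k) (MvPolynomial V k ⧸ I)) j))
    {W : Finset V} (hW : W.card < d) {e : MvPolynomial V k} (he : ∀ i ∉ W, X i * e ∈ I) :
    ∃ r, r - 1 ∈ maxIdeal k V ∧ r * e ∈ I := by
  have : Module.Finite (MvPolynomial V k)
      (ModuleCat.of (MvPolynomial V k) (MvPolynomial V k ⧸ I)) :=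
    inferInstanceAs (Module.Finite (MvPolynomial V k) (MvPolynomial V k ⧸ I))
  obtain ⟨r, hr, hr'⟩ := exists_smul_ext_facePrime_eq_zero hI W 0 (by omega)
  refine ⟨r, hr, ?_⟩
  let φ : ModuleCat.of (MvPolynomial V k) (MvPolynomial V k ⧸ facePrime k W) ⟶
      ModuleCat.of (MvPolynomial V k) (MvPolynomial V k ⧸ I) :=
    ModuleCat.ofHom (Submodule.mapQ (facePrime k W) I (LinearMap.toSpanSingleton _ _ e) (by
      refine Ideal.span_le.2 ?_
      rintro _ ⟨i, hi, rfl⟩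
      exact he i hi))
  have h1 := hr' (Abelian.Ext.mk₀ φ)
  rw [← Abelian.Ext.mk₀_smul, Abelian.Ext.mk₀_eq_zero_iff] at h1
  have h2 := congrArg (fun f => f.hom (Submodule.Quotient.mk 1)) h1
  have h3 : (Submodule.Quotient.mk (r * (1 * e)) : MvPolynomial V k ⧸ I) = 0 := h2
  rw [one_mul] at h3
  exact (Submodule.Quotient.mk_eq_zero _).1 h3

lemma exists_extension_of_ext [Finite V] {M : ModuleCat.{0} (MvPolynomial V k)}
    [Module.Finite (MvPolynomial V k) M] {d : ℕ}
    (hM : ∀ j < d, Subsingleton (Abelian.Ext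
      (ModuleCat.of (MvPolynomial V k) (MvPolynomial V k ⧸ maxIdeal k V)) M j))
    {W : Finset V} (hW : W.card + 1 < d) (φ : facePrime k W →ₗ[MvPolynomial V k] M) :
    ∃ r, r - 1 ∈ maxIdeal k V ∧ ∃ z : M, ∀ a : facePrime k W, r • φ a = a.1 • z := by
  obtain ⟨r, hr, hr'⟩ := exists_smul_ext_facePrime_eq_zero hM W 1 (by omega)
  refine ⟨r, hr, ?_⟩
  have hS : (ShortComplex.mk (ModuleCat.ofHom (facePrime k W).subtype)
      (ModuleCat.ofHom (facePrime k W).mkQ) (ModuleCat.hom_ext (LinearMap.ext fun x =>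
        (Submodule.Quotient.mk_eq_zero _).2 x.2))).ShortExact := by
    apply ModuleCat.shortComplex_shortExact
    · exact LinearMap.exact_subtype_mkQ _
    · exact Submodule.subtype_injective _
    · exact Submodule.mkQ_surjective _
  let ψ := ModuleCat.ofHom φ
  have h1 : hS.extClass.comp (Abelian.Ext.mk₀ (r • ψ)) (add_zero 1) = 0 := by
    rw [Abelian.Ext.mk₀_smul, Abelian.Ext.comp_smul]
    exact hr' _
  obtain ⟨y, hy⟩ := Abelian.Ext.contravariant_sequence_exact₁ hS M _ _ h1
  obtain ⟨y, rfl⟩ := (Abelian.Ext.mk₀_bijective _ _).2 y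
  rw [Abelian.Ext.mk₀_comp_mk₀] at hy
  have h2 := (Abelian.Ext.mk₀_bijective _ _).1 hy
  refine ⟨y.hom (1 : MvPolynomial V k), fun a => ?_⟩
  have h3 : y.hom (a.1 : MvPolynomial V k) = r • φ a := congrArg (fun f => f.hom a) h2
  rw [← h3, ← map_smul, smul_eq_mul, mul_one]

lemma exists_mul_sub_mul_mem [Finite V] {ι : Type} {Q : ι → Ideal (MvPolynomial V k)}
    {I : Ideal (MvPolynomial V k)} (hQ : ∀ x, x ∈ I ↔ ∀ F, x ∈ Q F) {d : ℕ}
    (hI : ∀ j < d, Subsingleton (Abelian.Ext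
      (ModuleCat.of (MvPolynomial V k) (MvPolynomial V k ⧸ maxIdeal k V))
      (ModuleCat.of (MvPolynomial V k) (MvPolynomial V k ⧸ I)) j))
    {W : Finset V} (hW : W.card + 1 < d) (e : ι → MvPolynomial V k)
    (he : ∀ i ∉ W, ∃ y, ∀ F, X i * e F - y ∈ Q F) :
    ∃ r, r - 1 ∈ maxIdeal k V ∧ ∃ z, ∀ i ∉ W, ∀ F, X i * (r * e F - z) ∈ Q F := by
  let S := MvPolynomial V k
  let ρ : (S ⧸ I) →ₗ[S] (∀ F, S ⧸ Q F) :=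
    LinearMap.pi fun F => Submodule.mapQ I (Q F) LinearMap.id fun x hx => (hQ x).1 hx F
  have hρ : Function.Injective ρ := by
    rw [injective_iff_map_eq_zero]
    intro x hx
    obtain ⟨x, rfl⟩ := Submodule.Quotient.mk_surjective _ x
    exact (Submodule.Quotient.mk_eq_zero _).2
      ((hQ x).2 fun F => (Submodule.Quotient.mk_eq_zero _).1 (congrFun hx F))
  let ψ : S →ₗ[S] (∀ F, S ⧸ Q F) :=
    LinearMap.toSpanSingleton S _ fun F => Submodule.Quotient.mk (e F)
  have hψ : facePrime k W ≤ (LinearMap.range ρ).comap ψ := by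
    refine Ideal.span_le.2 ?_
    rintro _ ⟨i, hi, rfl⟩
    obtain ⟨y, hy⟩ := he i hi
    exact ⟨Submodule.Quotient.mk y, funext fun F => ((Submodule.Quotient.eq _).2 (hy F)).symm⟩
  let φ : facePrime k W →ₗ[S] S ⧸ I :=
    (LinearEquiv.ofInjective ρ hρ).symm.toLinearMap ∘ₗ
      (ψ ∘ₗ (facePrime k W).subtype).codRestrict (LinearMap.range ρ) fun a => hψ a.2
  have hφ : ∀ a, ρ (φ a) = ψ a.1 := fun a =>
    congrArg Subtype.val ((LinearEquiv.ofInjective ρ hρ).apply_symm_apply _)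
  have : Module.Finite S (ModuleCat.of S (S ⧸ I)) := inferInstanceAs (Module.Finite S (S ⧸ I))
  obtain ⟨r, hr, z, hz⟩ := exists_extension_of_ext hI hW φ
  obtain ⟨z, rfl⟩ := Submodule.Quotient.mk_surjective _ z
  refine ⟨r, hr, z, fun i hi F => ?_⟩
  have h1 := congrArg ρ (hz ⟨X i, X_mem_facePrime hi⟩)
  have h2 := congrFun (((map_smul ρ _ _).trans (congrArg (r • ·) (hφ _))).symm.trans h1) F
  have h3 : r * (X i * e F) - X i * z ∈ Q F := (Submodule.Quotient.eq (Q F)).1 h2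
  have : X i * (r * e F - z) = r * (X i * e F) - X i * z := by ring
  rwa [this]

end Forward

section ForwardGraph
variable {k : Type} [Field k] {V : Type} [Fintype V] [DecidableEq V]

/-- The exponent of the squarefree monomial on `W`, squared. -/
noncomputable def squareExponent (W : Finset V) : V →₀ ℕ :=
  Finsupp.equivFunOnFinite.symm fun i => if i ∈ W then 2 else 0

lemma two_le_outDegree_squareExponent {F W : Finset V} (h : ¬ W ⊆ F) :
    2 ≤ outDegree F (squareExponent W) := by
  obtain ⟨w, hw, hwF⟩ := Finset.not_subset.1 h
  have : Finsupp.single w 2 ≤ squareExponent W := by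
    rw [Finsupp.single_le_iff]
    simp [squareExponent, hw]
  simpa [outDegree_single, hwF] using outDegree_mono F this

lemma outDegree_squareExponent_eq_zero {F W : Finset V} (h : W ⊆ F) :
    outDegree F (squareExponent W) = 0 := by
  refine Finset.sum_eq_zero fun i hi => ?_
  have : i ∉ W := fun hiW => Finset.mem_compl.1 hi (h hiW)
  simp [squareExponent, this]

omit [Fintype V] [DecidableEq V] in
lemma coeff_mul_monomial_self (r : MvPolynomial V k) (hr : r - 1 ∈ maxIdeal k V) (u : V →₀ ℕ) :
    coeff u (r * monomial u 1) = 1 := by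
  have h1 := coeff_mul_monomial 0 u (1 : k) r
  rw [zero_add, mul_one] at h1
  rw [h1, ← sub_eq_zero]
  have := mem_maxIdeal.1 hr
  rwa [coeff_sub, coeff_zero_one] at this

omit [Fintype V] [DecidableEq V] in
lemma X_mul_monomial (i : V) (u : V →₀ ℕ) :
    (X i * monomial u 1 : MvPolynomial V k) = monomial (Finsupp.single i 1 + u) 1 := by
  rw [X, monomial_mul, one_mul]

lemma facets_card_le {Δ : Set (Finset V)} (h : quotCM k V (symbolicPower k Δ 2))
    {F W : Finset V} (hF : F ∈ facets Δ) (hW : W ∈ facets Δ) : F.card ≤ W.card := by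
  by_contra! hlt
  obtain ⟨p, -, hp⟩ := Finset.exists_mem_notMem_of_card_lt_card hlt
  let u := Finsupp.single p 1 + squareExponent W
  obtain ⟨r, hr, hr'⟩ := exists_mul_mem_of_ext (k := k)
    (fun j hj => h.subsingleton_ext (symbolicPower_two_le hF) j hj) hlt
    (e := monomial u 1) (fun i hi => by
      rw [X_mul_monomial, mem_symbolicPower]
      intro H hH
      apply monomial_mem_facePrime_sq
      rw [outDegree_add, outDegree_add]
      by_cases hWH : W ⊆ H
      · have : W = H := hW.2 H hH.1 hWH
        subst this
        simp [outDegree_single, hi, hp]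
        omega
      · have := two_le_outDegree_squareExponent hWH
        omega)
  have h1 := coeff_eq_zero_of_mem_facePrime_sq (mem_symbolicPower.1 hr' W hW) (m := u) (by
    rw [outDegree_add, outDegree_squareExponent_eq_zero le_rfl]
    simp [outDegree_single, hp])
  rw [coeff_mul_monomial_self r hr] at h1
  exact one_ne_zero h1

lemma exists_adjacent_facets {G : SimpleGraph V}
    (h : quotCM k V (symbolicPower k (indepComplex G) 2)) {p q : V} (hpq : G.Adj p q) :
    ∃ W : Finset V, insert p W ∈ facets (indepComplex G) ∧
      insert q W ∈ facets (indepComplex G) := by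
  have hsing : ∀ v : V, ({v} : Finset V) ∈ indepComplex G := fun v => by
    simp [indepComplex]
  obtain ⟨F₀, hF₀, hpF₀⟩ := exists_facet (hsing p)
  obtain ⟨F₁, hF₁, hqF₁⟩ := exists_facet (hsing q)
  rw [Finset.singleton_subset_iff] at hpF₀ hqF₁
  obtain ⟨⟨F, F'⟩, ⟨⟨hF, hpF⟩, hF', hqF'⟩, hmax⟩ := Set.exists_max_image
    {P : Finset V × Finset V | (P.1 ∈ facets (indepComplex G) ∧ p ∈ P.1) ∧
      P.2 ∈ facets (indepComplex G) ∧ q ∈ P.2} (fun P => (P.1 ∩ P.2).card) (Set.toFinite _)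
    ⟨(F₀, F₁), ⟨hF₀, hpF₀⟩, hF₁, hqF₁⟩
  have hpq' : ∀ H ∈ facets (indepComplex G), p ∈ H → q ∉ H := fun H hH hp hq =>
    hH.1 p hp q hq hpq
  have hW1 : F ∩ F' ⊆ F := Finset.inter_subset_left
  have hW2 : F ∩ F' ⊆ F' := Finset.inter_subset_right
  generalize hW : F ∩ F' = W at *
  have hpW : p ∉ W := fun hp => hpq' F' hF' (hW2 hp) hqF'
  have hqW : q ∉ W := fun hq => hpq' F hF hpF (hW1 hq)
  have hcard : F'.card = F.card := le_antisymm (facets_card_le h hF' hF) (facets_card_le h hF hF')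
  have hi1 : insert p W ⊆ F := Finset.insert_subset hpF hW1
  have hi2 : insert q W ⊆ F' := Finset.insert_subset hqF' hW2
  have hle := Finset.card_le_card hi1
  rw [Finset.card_insert_of_notMem hpW] at hle
  rcases hle.eq_or_lt with heq | hlt
  · refine ⟨W, ?_, ?_⟩
    · rwa [Finset.eq_of_subset_of_card_le hi1 (by rw [Finset.card_insert_of_notMem hpW, heq])]
    · rwa [Finset.eq_of_subset_of_card_le hi2
        (by rw [Finset.card_insert_of_notMem hqW, heq, hcard])]
  exfalso
  let u := Finsupp.single p 1 + (Finsupp.single q 1 + squareExponent W)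
  have hu : ∀ H, W ⊆ H → outDegree H u = (if p ∈ H then 0 else 1) + if q ∈ H then 0 else 1 := by
    intro H hH
    simp only [u, outDegree_add, outDegree_squareExponent_eq_zero hH, outDegree_single, add_zero]
  have hu' : ∀ H, ¬ W ⊆ H → 2 ≤ outDegree H u := by
    intro H hH
    simp only [u, outDegree_add]
    have := two_le_outDegree_squareExponent hH
    omega
  obtain ⟨r, hr, z, hz⟩ := exists_mul_sub_mul_mem (k := k) (ι := facets (indepComplex G))
    (Q := fun H => facePrime k H.1 ^ 2) (I := symbolicPower k (indepComplex G) 2)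
    (fun x => by simp [mem_symbolicPower])
    (fun j hj => h.subsingleton_ext (symbolicPower_two_le hF) j hj) hlt
    (fun H => if insert p W ⊆ H.1 then monomial u 1 else 0) (by
      intro i hi
      by_cases hiF : ∃ H ∈ facets (indepComplex G), insert p W ⊆ H ∧ i ∈ H
      · refine ⟨X i * monomial u 1, fun H => ?_⟩
        obtain ⟨H₁, hH₁, hpH₁, hiH₁⟩ := hiF
        by_cases hH : insert p W ⊆ H.1
        · simp [hH]
        · simp only [hH, if_false, mul_zero, zero_sub, neg_mem_iff, X_mul_monomial]
          apply monomial_mem_facePrime_sq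
          rw [outDegree_add]
          by_cases hWH : W ⊆ H.1
          · have hpH : p ∉ H.1 := fun hp => hH (Finset.insert_subset hp hWH)
            rw [hu _ hWH, outDegree_single]
            by_cases hqH : q ∈ H.1
            · have hiH : i ∉ H.1 := by
                intro hiH
                have := hmax (H₁, H.1) ⟨⟨hH₁, hpH₁ (Finset.mem_insert_self _ _)⟩, H.2, hqH⟩
                have h2 : insert i W ⊆ H₁ ∩ H.1 := Finset.insert_subset
                  (Finset.mem_inter.2 ⟨hiH₁, hiH⟩)
                  (Finset.subset_inter ((Finset.subset_insert _ _).trans hpH₁) hWH)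
                have h3 := Finset.card_le_card h2
                rw [Finset.card_insert_of_notMem hi] at h3
                simp only at this
                omega
              simp [hpH, hqH, hiH]
            · simp [hpH, hqH]
          · have := hu' _ hWH
            omega
      · refine ⟨0, fun H => ?_⟩
        by_cases hH : insert p W ⊆ H.1
        · simp only [hH, if_true, sub_zero, X_mul_monomial]
          apply monomial_mem_facePrime_sq
          have hpH := hH (Finset.mem_insert_self _ _)
          have hiH : i ∉ H.1 := fun hiH => hiF ⟨H.1, H.2, hH, hiH⟩
          rw [outDegree_add, hu _ ((Finset.subset_insert _ _).trans hH), outDegree_single]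
          simp [hpH, hpq' _ H.2 hpH, hiH]
        · simp [hH])
  have h1 := coeff_eq_zero_of_mem_facePrime_sq (hz p hpW ⟨F, hF⟩) (m := Finsupp.single p 1 + u) (by
    rw [outDegree_add, hu _ hW1]
    simp [outDegree_single, hpF, hpq' F hF hpF])
  have h2 := coeff_eq_zero_of_mem_facePrime_sq (hz q hqW ⟨F', hF'⟩)
    (m := Finsupp.single q 1 + u) (by
    rw [outDegree_add, hu _ hW2]
    simp [outDegree_single, hqF']
    split_ifs <;> omega)
  have hpF' : ¬ insert p W ⊆ F' := fun hs =>
    hpq' F' hF' (hs (Finset.mem_insert_self _ _)) hqF'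
  rw [coeff_X_mul] at h1 h2
  simp only [hi1, if_true, coeff_sub, coeff_mul_monomial_self r hr] at h1
  simp only [hpF', if_false, mul_zero, zero_sub, coeff_neg, neg_eq_zero] at h2
  rw [h2, sub_zero] at h1
  exact one_ne_zero h1

end ForwardGraph

section Bipartite
variable {V : Type} [Fintype V] [DecidableEq V]

lemma existsUnique_adj_of_color {G : SimpleGraph V} (C : G.Coloring (Fin 2))
    (hiso : noIsolated G)
    (hcard : ∀ F ∈ facets (indepComplex G), ∀ F' ∈ facets (indepComplex G), F.card ≤ F'.card)
    (hfacet : ∀ H ∈ indepComplex G, ∃ F ∈ facets (indepComplex G), H ⊆ F)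
    (hadj : ∀ p q, G.Adj p q → ∃ W : Finset V, insert p W ∈ facets (indepComplex G) ∧
      insert q W ∈ facets (indepComplex G)) (v : V) : ∃! w, G.Adj v w := by
  classical
  have hclass : ∀ c, Finset.univ.filter (fun v => C v = c) ∈ facets (indepComplex G) := by
    refine fun c => ⟨fun i hi j hj hij => ?_, fun H hH hle => hle.antisymm fun i hi => ?_⟩
    · simp only [Finset.mem_filter, Finset.mem_univ, true_and] at hi hj
      exact C.valid hij (hi.trans hj.symm)
    · by_contra hic
      simp only [Finset.mem_filter, Finset.mem_univ, true_and] at hic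
      obtain ⟨j, hj⟩ := hiso i
      refine hH i hi j (hle ?_) hj
      have := C.valid hj
      simp only [Finset.mem_filter, Finset.mem_univ, true_and]
      omega
  set A := Finset.univ.filter (fun w => C w = C v) with hA
  set B := Finset.univ.filter (fun w => C w = C v + 1) with hB
  have hmA : ∀ w, w ∈ A ↔ C w = C v := by simp [hA]
  have hmB : ∀ w, w ∈ B ↔ C w ≠ C v := by
    simp only [hB, Finset.mem_filter, Finset.mem_univ, true_and]
    intro w
    omega
  have hAf : A ∈ facets (indepComplex G) := hclass _
  have hBf : B ∈ facets (indepComplex G) := hclass _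
  have hAB : ∀ a ∈ A, ∀ b, G.Adj a b → b ∈ B := fun a ha b hab =>
    (hmB b).2 fun h => C.valid hab (((hmA a).1 ha).trans h.symm)
  obtain ⟨f, hf, hfadj⟩ := (Finset.all_card_le_biUnion_card_iff_exists_injective
    (fun a : A => Finset.univ.filter (G.Adj a))).1 (by
      intro s
      set N := s.biUnion fun a : A => Finset.univ.filter (G.Adj a) with hN
      have hNB : N ⊆ B := fun b hb => by
        obtain ⟨a, -, hab⟩ := Finset.mem_biUnion.1 hb
        exact hAB a a.2 b (Finset.mem_filter.1 hab).2
      have hS : ∀ i ∈ s.map (Function.Embedding.subtype _), i ∈ A := by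
        intro i hi
        obtain ⟨a, -, rfl⟩ := Finset.mem_map.1 hi
        exact a.2
      have hSN : ∀ i ∈ s.map (Function.Embedding.subtype _), ∀ j, G.Adj i j → j ∈ N := by
        intro i hi j hij
        obtain ⟨a, ha, rfl⟩ := Finset.mem_map.1 hi
        exact Finset.mem_biUnion.2 ⟨a, ha, Finset.mem_filter.2 ⟨Finset.mem_univ _, hij⟩⟩
      obtain ⟨H, hH, hle⟩ := hfacet (s.map (Function.Embedding.subtype _) ∪ (B \ N)) (by
        intro i hi j hj hij
        rcases Finset.mem_union.1 hi with hi | hi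
        · have hjN := hSN i hi j hij
          rcases Finset.mem_union.1 hj with hj | hj
          · exact hAf.1 i (hS i hi) j (hS j hj) hij
          · exact (Finset.mem_sdiff.1 hj).2 hjN
        · rcases Finset.mem_union.1 hj with hj | hj
          · exact (Finset.mem_sdiff.1 hi).2 (hSN j hj i hij.symm)
          · exact hBf.1 i (Finset.mem_sdiff.1 hi).1 j (Finset.mem_sdiff.1 hj).1 hij)
      have h1 := Finset.card_le_card hle
      rw [Finset.card_union_of_disjoint, Finset.card_map, Finset.card_sdiff_of_subset hNB] at h1
      · have h2 := hcard H hH B hBf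
        have h3 := Finset.card_le_card hNB
        omega
      · refine Finset.disjoint_left.2 fun i hi hi' => ?_
        exact (hmB i).1 (Finset.mem_sdiff.1 hi').1 ((hmA i).1 (hS i hi)))
  replace hfadj : ∀ a : A, G.Adj a (f a) := fun a => (Finset.mem_filter.1 (hfadj a)).2
  have hsurj : Finset.univ.image f = B := by
    refine Finset.eq_of_subset_of_card_le (fun b hb => ?_) ?_
    · obtain ⟨a, -, rfl⟩ := Finset.mem_image.1 hb
      exact hAB a a.2 _ (hfadj a)
    · rw [Finset.card_image_of_injective _ hf, Finset.card_univ, Fintype.card_coe]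
      exact hcard B hBf A hAf
  have hmeet : ∀ H ∈ facets (indepComplex G), ∀ a : A, (a : V) ∉ H → f a ∈ H := by
    intro H hH a haH
    by_contra hfa
    let T₁ : Finset A := (Finset.univ.erase a).filter fun x => (x : V) ∈ H
    let T₂ : Finset A := (Finset.univ.erase a).filter fun x => f x ∈ H
    have h1 : H ⊆ T₁.map (Function.Embedding.subtype _) ∪ T₂.image f := by
      intro i hi
      by_cases hiA : i ∈ A
      · refine Finset.mem_union_left _ (Finset.mem_map.2 ⟨⟨i, hiA⟩, ?_, rfl⟩)
        simp only [T₁, Finset.mem_filter, Finset.mem_erase, Finset.mem_univ, and_true, hi]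
        rintro rfl
        exact haH hi
      · have hiB : i ∈ B := (hmB i).2 (fun h => hiA ((hmA i).2 h))
        rw [← hsurj] at hiB
        obtain ⟨x, -, rfl⟩ := Finset.mem_image.1 hiB
        refine Finset.mem_union_right _ (Finset.mem_image.2 ⟨x, ?_, rfl⟩)
        simp only [T₂, Finset.mem_filter, Finset.mem_erase, Finset.mem_univ, and_true, hi]
        rintro rfl
        exact hfa hi
    have h2 := (Finset.card_le_card h1).trans (Finset.card_union_le _ _)
    rw [Finset.card_map] at h2
    have h3 : (T₂.image f).card ≤ T₂.card := Finset.card_image_le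
    have h4 : (T₁ ∪ T₂).card = T₁.card + T₂.card := by
      refine Finset.card_union_of_disjoint (Finset.disjoint_left.2 fun x hx hx' => ?_)
      exact hH.1 x (Finset.mem_filter.1 hx).2 (f x) (Finset.mem_filter.1 hx').2 (hfadj x)
    have h5 : (T₁ ∪ T₂).card ≤ (Finset.univ.erase a).card := Finset.card_le_card
      (Finset.union_subset (Finset.filter_subset _ _) (Finset.filter_subset _ _))
    have h6 := Finset.card_erase_lt_of_mem (Finset.mem_univ a)
    rw [Finset.card_univ, Fintype.card_coe] at h6
    have h7 := hcard A hAf H hH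
    omega
  have hvA : v ∈ A := (hmA v).2 rfl
  refine ⟨f ⟨v, hvA⟩, hfadj ⟨v, hvA⟩, fun q hq => ?_⟩
  obtain ⟨W, hpW, hqW⟩ := hadj v q hq
  by_contra hne
  have hv : v ∉ insert q W := fun h => hqW.1 v h q (Finset.mem_insert_self _ _) hq
  have h1 := hmeet _ hqW ⟨v, hvA⟩ hv
  rw [Finset.mem_insert] at h1
  rcases h1 with h1 | h1
  · exact hne h1.symm
  · exact hpW.1 v (Finset.mem_insert_self _ _) _ (Finset.mem_insert_of_mem h1) (hfadj ⟨v, hvA⟩)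

end Bipartite

section MonomialIdeal
variable {k : Type} [Field k] {V : Type}

lemma mem_restrictSupportIdeal {U : Set (V →₀ ℕ)} (hU : IsUpperSet U) {x : MvPolynomial V k} :
    x ∈ restrictSupportIdeal k U hU ↔ ∀ m ∈ x.support, m ∈ U :=
  Iff.rfl

lemma mem_restrictSupportIdeal_iff_monomial_mul {U U' : Set (V →₀ ℕ)} (hU : IsUpperSet U)
    (hU' : IsUpperSet U') {u : V →₀ ℕ} (h : ∀ m, m ∈ U' ↔ u + m ∈ U) (b : MvPolynomial V k) :
    b ∈ restrictSupportIdeal k U' hU' ↔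
      monomial u 1 * b ∈ restrictSupportIdeal k U hU := by
  simp only [mem_restrictSupportIdeal, mem_support_iff]
  constructor
  · intro hb m hm
    rw [coeff_monomial_mul'] at hm
    split_ifs at hm with hum
    · rw [one_mul] at hm
      rw [← add_tsub_cancel_of_le hum, ← h]
      exact hb _ hm
    · exact absurd rfl hm
  · intro hb m hm
    rw [h]
    apply hb
    rwa [coeff_monomial_mul, one_mul]

lemma restrictSupportIdeal_eq_sup_span {U U'' : Set (V →₀ ℕ)} (hU : IsUpperSet U)
    (hU'' : IsUpperSet U'') {u : V →₀ ℕ} (h : ∀ m, m ∈ U'' ↔ m ∈ U ∨ u ≤ m) :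
    restrictSupportIdeal k U'' hU'' =
      restrictSupportIdeal k U hU ⊔ Ideal.span {monomial u 1} := by
  refine le_antisymm (fun x hx => ?_) (sup_le (fun x hx m hm => ?_) ?_)
  · rw [x.as_sum]
    refine sum_mem fun m hm => ?_
    rcases (h m).1 (hx hm) with hm' | hm'
    · refine Ideal.mem_sup_left ((mem_restrictSupportIdeal hU).2 fun m₁ hm₁ => ?_)
      rwa [Finset.mem_singleton.1 (support_monomial_subset hm₁)]
    · refine Ideal.mem_sup_right (Ideal.mem_span_singleton'.2
        ⟨monomial (m - u) (coeff m x), ?_⟩)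
      rw [monomial_mul, mul_one, tsub_add_cancel_of_le hm']
  · exact (h m).2 (Or.inl (hx hm))
  · rw [Ideal.span_singleton_le_iff_mem, mem_restrictSupportIdeal]
    intro m hm
    rw [Finset.mem_singleton.1 (support_monomial_subset hm)]
    exact (h u).2 (Or.inr le_rfl)

/-- `Ext^i(S/m, S/I)` vanishes for all `i < d`. -/
def ExtVanishesBelow (d : ℕ) (I : Ideal (MvPolynomial V k)) : Prop :=
  ∀ i < d, Subsingleton (Abelian.Ext
    (ModuleCat.of (MvPolynomial V k) (MvPolynomial V k ⧸ maxIdeal k V))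
    (ModuleCat.of (MvPolynomial V k) (MvPolynomial V k ⧸ I)) i)

lemma extVanishesBelow_of_upperSet {d : ℕ} {U U' U'' : Set (V →₀ ℕ)} (hU : IsUpperSet U)
    (hU' : IsUpperSet U') (hU'' : IsUpperSet U'') {u : V →₀ ℕ}
    (h : ∀ m, m ∈ U' ↔ u + m ∈ U) (h' : ∀ m, m ∈ U'' ↔ m ∈ U ∨ u ≤ m)
    (h1 : ExtVanishesBelow d (restrictSupportIdeal k U' hU'))
    (h2 : ExtVanishesBelow d (restrictSupportIdeal k U'' hU'')) :
    ExtVanishesBelow d (restrictSupportIdeal k U hU) := fun i hi =>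
  subsingleton_ext_quotient_of_colon (mem_restrictSupportIdeal_iff_monomial_mul hU hU' h)
    (restrictSupportIdeal_eq_sup_span hU hU'' h') _ i (h1 i hi) (h2 i hi)

lemma extVanishesBelow_facePrime (F : Finset V) :
    ExtVanishesBelow F.card (facePrime k F) := by
  classical
  induction F using Finset.induction with
  | empty => exact fun i hi => absurd hi (by simp)
  | insert w F hw ih =>
    intro i hi
    rw [Finset.card_insert_of_notMem hw] at hi
    refine subsingleton_of_forall_eq 0 fun x => ?_
    refine comp_colonMap_injective (mem_facePrime_iff_X_mul (Finset.mem_insert_self w F))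
      (facePrime_erase hw) _ i (fun j hj => ih j (by omega)) x ?_
    have h0 : (X w : MvPolynomial V k) •
        𝟙 (ModuleCat.of (MvPolynomial V k) (MvPolynomial V k ⧸ maxIdeal k V)) = 0 := by
      refine ModuleCat.hom_ext (LinearMap.ext fun y => ?_)
      obtain ⟨y, rfl⟩ := Submodule.Quotient.mk_surjective _ y
      exact (Submodule.Quotient.mk_eq_zero _).2
        (Ideal.mul_mem_right _ _ (Ideal.subset_span ⟨w, rfl⟩))
    have h1 : (X w : MvPolynomial V k) • x = 0 := by
      have h2 := congrArg (fun f => (Abelian.Ext.mk₀ f).comp x (zero_add i)) h0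
      simpa only [Abelian.Ext.mk₀_smul, Abelian.Ext.smul_comp, Abelian.Ext.mk₀_id_comp,
        Abelian.Ext.mk₀_zero, Abelian.Ext.zero_comp] using h2
    rw [colonMap_self, Abelian.Ext.mk₀_smul, Abelian.Ext.comp_smul, Abelian.Ext.comp_mk₀_id, h1]

/-- The exponents of the monomials divisible by `x_c x_{σ c}` for some `c ∈ C`, or by `x_i` for
some `i ∈ Y`. -/
def edgeSet (σ : V → V) (C Y : Finset V) : Set (V →₀ ℕ) :=
  {m | (∃ c ∈ C, 1 ≤ m c ∧ 1 ≤ m (σ c)) ∨ ∃ i ∈ Y, 1 ≤ m i}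

lemma isUpperSet_edgeSet (σ : V → V) (C Y : Finset V) : IsUpperSet (edgeSet σ C Y) := by
  rintro m m' h (⟨c, hc, h1, h2⟩ | ⟨i, hi, h1⟩)
  · exact Or.inl ⟨c, hc, h1.trans (h c), h2.trans (h _)⟩
  · exact Or.inr ⟨i, hi, h1.trans (h i)⟩

/-- The exponents of the monomials in `(x_b x_{σ b} : b ∈ B)² + (x_c x_{σ c} : c ∈ C)`. -/
def edgeSqSet (σ : V → V) (B C : Finset V) : Set (V →₀ ℕ) :=
  {m | 2 ≤ ∑ b ∈ B, min (m b) (m (σ b)) ∨ ∃ c ∈ C, 1 ≤ m c ∧ 1 ≤ m (σ c)}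

lemma isUpperSet_edgeSqSet (σ : V → V) (B C : Finset V) : IsUpperSet (edgeSqSet σ B C) := by
  rintro m m' h (h1 | ⟨c, hc, h1, h2⟩)
  · exact Or.inl (h1.trans (Finset.sum_le_sum fun b _ => min_le_min (h b) (h _)))
  · exact Or.inr ⟨c, hc, h1.trans (h c), h2.trans (h _)⟩

variable [Fintype V] [DecidableEq V]

lemma restrictSupportIdeal_edgeSet_empty (σ : V → V) (Y : Finset V) :
    restrictSupportIdeal k (edgeSet σ ∅ Y) (isUpperSet_edgeSet σ ∅ Y) =
      facePrime k Yᶜ := by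
  ext x
  simp [mem_restrictSupportIdeal, mem_facePrime, edgeSet, Nat.one_le_iff_ne_zero]

lemma extVanishesBelow_edgeSet {σ : V → V} {A : Finset V} (hσA : ∀ a ∈ A, σ a ∉ A)
    (hσ : Set.InjOn σ A) (C Y : Finset V) (hC : C ⊆ A) (hCY : ∀ c ∈ C, c ∉ Y ∧ σ c ∉ Y) (d : ℕ)
    (hd : d + C.card + Y.card ≤ Fintype.card V) :
    ExtVanishesBelow d (restrictSupportIdeal k (edgeSet σ C Y)
      (isUpperSet_edgeSet σ C Y)) := by
  induction C using Finset.induction generalizing Y with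
  | empty =>
    rw [restrictSupportIdeal_edgeSet_empty]
    refine fun i hi => extVanishesBelow_facePrime _ i ?_
    rw [Finset.card_compl]
    simp only [Finset.card_empty] at hd
    omega
  | insert e C he ih =>
    obtain ⟨heA, hCA⟩ := Finset.insert_subset_iff.1 hC
    have hne : σ e ≠ e := fun h => hσA e heA (h.symm ▸ heA)
    have h1 : ∀ c ∈ C, e ≠ c ∧ e ≠ σ c ∧ c ≠ σ e ∧ σ c ≠ σ e := by
      intro c hc
      have hec : e ≠ c := fun h => he (h ▸ hc)
      exact ⟨hec, fun h => hσA c (hCA hc) (h ▸ heA), fun h => hσA e heA (h ▸ hCA hc),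
        fun h => hec (hσ heA (hCA hc) h.symm)⟩
    obtain ⟨heY, hσeY⟩ := hCY e (Finset.mem_insert_self _ _)
    rw [Finset.card_insert_of_notMem he] at hd
    have hCY' : ∀ c ∈ C, c ∉ Y ∧ σ c ∉ Y := fun c hc => hCY c (Finset.mem_insert_of_mem hc)
    refine extVanishesBelow_of_upperSet _ (isUpperSet_edgeSet σ C (insert (σ e) Y))
      (isUpperSet_edgeSet σ C (insert e Y)) (u := Finsupp.single e 1) (fun m => ?_) (fun m => ?_)
      (ih _ hCA (fun c hc => ?_) ?_) (ih _ hCA (fun c hc => ?_) ?_)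
    · set u : V →₀ ℕ := Finsupp.single e 1 + m with hu
      have huc : ∀ i, e ≠ i → u i = m i := fun i hi => by simp [hu, hi.symm]
      have hC : (∃ c ∈ C, 1 ≤ u c ∧ 1 ≤ u (σ c)) ↔ ∃ c ∈ C, 1 ≤ m c ∧ 1 ≤ m (σ c) :=
        exists_congr fun c => and_congr_right fun hc => by
          rw [huc _ (h1 c hc).1, huc _ (h1 c hc).2.1]
      have hY : (∃ i ∈ Y, 1 ≤ u i) ↔ ∃ i ∈ Y, 1 ≤ m i :=
        exists_congr fun i => and_congr_right fun hi => by rw [huc i fun h => heY (h ▸ hi)]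
      have he1 : 1 ≤ u e := by simp [hu]
      simp only [edgeSet, Set.mem_ofPred_eq, Finset.exists_mem_insert, hC, hY, he1,
        huc _ hne.symm, true_and]
      rw [or_left_comm, or_assoc]
    · simp only [edgeSet, Set.mem_ofPred_eq, Finset.exists_mem_insert, Finsupp.single_le_iff]
      constructor
      · rintro (h | h | h)
        exacts [Or.inl (Or.inl (Or.inr h)), Or.inr h, Or.inl (Or.inr h)]
      · rintro (((h | h) | h) | h)
        exacts [Or.inr (Or.inl h.1), Or.inl h, Or.inr (Or.inr h), Or.inr (Or.inl h)]
    · simp only [Finset.mem_insert, not_or]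
      exact ⟨⟨(h1 c hc).2.2.1, (hCY' c hc).1⟩, (h1 c hc).2.2.2, (hCY' c hc).2⟩
    · rw [Finset.card_insert_of_notMem hσeY]; omega
    · simp only [Finset.mem_insert, not_or]
      exact ⟨⟨(h1 c hc).1.symm, (hCY' c hc).1⟩, (h1 c hc).2.1.symm, (hCY' c hc).2⟩
    · rw [Finset.card_insert_of_notMem heY]; omega

lemma extVanishesBelow_edgeSqSet {σ : V → V} {A : Finset V} (hσA : ∀ a ∈ A, σ a ∉ A)
    (hσ : Set.InjOn σ A) (B C : Finset V) (hBA : B ⊆ A) (hCA : C ⊆ A) (hBC : Disjoint B C) (d : ℕ)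
    (hd : d + B.card + C.card ≤ Fintype.card V) :
    ExtVanishesBelow d (restrictSupportIdeal k (edgeSqSet σ B C)
      (isUpperSet_edgeSqSet σ B C)) := by
  induction B using Finset.induction generalizing C with
  | empty =>
    have h1 := extVanishesBelow_edgeSet (k := k) hσA hσ C ∅ hCA (by simp) d (by simpa using hd)
    convert h1 using 2
    simp [edgeSqSet, edgeSet]
  | insert e B he ih =>
    obtain ⟨heA, hBA⟩ := Finset.insert_subset_iff.1 hBA
    obtain ⟨heC, hBC⟩ := Finset.disjoint_insert_left.1 hBC
    rw [Finset.card_insert_of_notMem he] at hd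
    have hne : σ e ≠ e := fun h => hσA e heA (h.symm ▸ heA)
    have hsep : ∀ c ∈ A, e ≠ c → e ≠ σ c ∧ c ≠ σ e ∧ σ c ≠ σ e := by
      intro c hc hec
      exact ⟨fun h => hσA c hc (h ▸ heA), fun h => hσA e heA (h ▸ hc),
        fun h => hec (hσ heA hc h.symm)⟩
    refine extVanishesBelow_of_upperSet _ (isUpperSet_edgeSet σ (insert e (B ∪ C)) ∅)
      (isUpperSet_edgeSqSet σ B (insert e C))
      (u := Finsupp.single e 1 + Finsupp.single (σ e) 1) (fun m => ?_) (fun m => ?_)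
      (extVanishesBelow_edgeSet hσA hσ _ _
        (Finset.insert_subset heA (Finset.union_subset hBA hCA)) (by simp) d ?_)
      (ih _ hBA (Finset.insert_subset heA hCA) (Finset.disjoint_insert_right.2 ⟨he, hBC⟩) ?_)
    · set u : V →₀ ℕ := Finsupp.single e 1 + Finsupp.single (σ e) 1 + m with hu
      have hue : u e = m e + 1 := by simp [hu, hne]; omega
      have huσ : u (σ e) = m (σ e) + 1 := by simp [hu, hne.symm]; omega
      have huc : ∀ c ∈ A, e ≠ c → u c = m c ∧ u (σ c) = m (σ c) := by
        intro c hc hec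
        obtain ⟨h1, h2, h3⟩ := hsep c hc hec
        simp [hu, hec, h1, h2.symm, h3.symm]
      have hB : ∑ b ∈ B, min (u b) (u (σ b)) = ∑ b ∈ B, min (m b) (m (σ b)) :=
        Finset.sum_congr rfl fun b hb => by
          obtain ⟨h1, h2⟩ := huc b (hBA hb) (fun h => he (h ▸ hb))
          rw [h1, h2]
      have hC : (∃ c ∈ C, 1 ≤ u c ∧ 1 ≤ u (σ c)) ↔ ∃ c ∈ C, 1 ≤ m c ∧ 1 ≤ m (σ c) :=
        exists_congr fun c => and_congr_right fun hc => by
          obtain ⟨h1, h2⟩ := huc c (hCA hc) (fun h => heC (h ▸ hc))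
          rw [h1, h2]
      have hB1 : (∃ b ∈ B, 1 ≤ m b ∧ 1 ≤ m (σ b)) ↔ 1 ≤ ∑ b ∈ B, min (m b) (m (σ b)) := by
        rw [Nat.one_le_iff_ne_zero, Ne, Finset.sum_eq_zero_iff]
        push Not
        refine exists_congr fun b => and_congr_right fun _ => ?_
        omega
      simp only [edgeSet, edgeSqSet, Set.mem_ofPred_eq, Finset.sum_insert he, hB, hC, hue, huσ,
        Finset.exists_mem_insert, Finset.mem_union, or_and_right, exists_or, hB1,
        Finset.notMem_empty, false_and, exists_false, or_false]
      rw [← or_assoc]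
      refine or_congr_left ?_
      omega
    · have hle : Finsupp.single e 1 + Finsupp.single (σ e) 1 ≤ m ↔ 1 ≤ m e ∧ 1 ≤ m (σ e) := by
        constructor
        · intro h
          have h1 := h e
          have h2 := h (σ e)
          simp [hne, hne.symm] at h1 h2
          omega
        · rintro ⟨h1, h2⟩ i
          by_cases hi : e = i
          · subst hi; simpa [hne] using h1
          · by_cases hi' : σ e = i
            · subst hi'; simpa [hi] using h2
            · simp [hi, hi']
      simp only [edgeSqSet, Set.mem_ofPred_eq, Finset.sum_insert he, Finset.exists_mem_insert, hle]
      by_cases h1 : 1 ≤ m e ∧ 1 ≤ m (σ e)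
      · simp [h1]
      · have : min (m e) (m (σ e)) = 0 := by omega
        simp [h1, this]
    · rw [Finset.card_insert_of_notMem (by simp [he, heC]), Finset.card_union_of_disjoint hBC]
      simp only [Finset.card_empty]
      omega
    · rw [Finset.card_insert_of_notMem heC]; omega

end MonomialIdeal

section Dimension

lemma ringKrullDim_quotient_le_of_forall_isPrime {R : Type*} [CommRing R] (I : Ideal R)
    (d : WithBot ℕ∞) (h : ∀ p : Ideal R, p.IsPrime → I ≤ p → ringKrullDim (R ⧸ p) ≤ d) :
    ringKrullDim (R ⧸ I) ≤ d := by
  rw [ringKrullDim_quotient, Order.krullDim_eq_iSup_coheight]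
  refine iSup_le fun p => ?_
  refine le_trans ?_ (h p.1.asIdeal p.1.isPrime p.2)
  rw [ringKrullDim_quotient, Order.coheight_eq_krullDim_Ici]
  exact Order.krullDim_le_of_strictMono
    (fun q : Set.Ici p => (⟨q.1.1, q.2⟩ : PrimeSpectrum.zeroLocus (p.1.asIdeal : Set R)))
    (fun q q' h => h)

variable {k : Type} [Field k] {V : Type} [Fintype V] [DecidableEq V]

lemma ringKrullDim_quotient_facePrime_le (F : Finset V) :
    ringKrullDim (MvPolynomial V k ⧸ facePrime k F) ≤ F.card := by
  let f : MvPolynomial F k →ₐ[k] MvPolynomial V k ⧸ facePrime k F :=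
    aeval fun i => Ideal.Quotient.mk _ (X i.1)
  have hsurj : Function.Surjective f := by
    have h : ∀ x, Ideal.Quotient.mkₐ k (facePrime k F) x ∈ f.range := by
      intro x
      have hx : x ∈ Algebra.adjoin k (Set.range (X : V → MvPolynomial V k)) := by
        rw [adjoin_range_X]; trivial
      have hle : Algebra.adjoin k (Set.range (X : V → MvPolynomial V k)) ≤
          f.range.comap (Ideal.Quotient.mkₐ k (facePrime k F)) := by
        rw [Algebra.adjoin_le_iff]
        rintro _ ⟨i, rfl⟩
        by_cases hi : i ∈ F
        · exact ⟨X ⟨i, hi⟩, by simp [f]⟩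
        · exact ⟨0, (map_zero f).trans (Ideal.Quotient.eq_zero_iff_mem.2 (X_mem_facePrime hi)).symm⟩
      exact hle hx
    intro y
    obtain ⟨x, rfl⟩ := Ideal.Quotient.mk_surjective y
    exact h x
  refine (ringKrullDim_le_of_surjective f.toRingHom hsurj).trans ?_
  rw [MvPolynomial.ringKrullDim_of_isNoetherianRing]
  simp

/-- The square of the edge ideal of a matching is Cohen–Macaulay. -/
lemma quotCM_of_forall_mem_iff {σ : V → V} {A : Finset V} (hσA : ∀ a ∈ A, σ a ∉ A)
    (hσ : Set.InjOn σ A) {I : Ideal (MvPolynomial V k)}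
    (hI : ∀ x, x ∈ I ↔ ∀ m ∈ x.support, 2 ≤ ∑ a ∈ A, min (m a) (m (σ a))) : quotCM k V I := by
  have hI' : I = restrictSupportIdeal k (edgeSqSet σ A ∅) (isUpperSet_edgeSqSet σ A ∅) := by
    ext x
    simp [hI, mem_restrictSupportIdeal, edgeSqSet]
  have hmax : I ≤ maxIdeal k V := by
    intro x hx
    rw [mem_maxIdeal]
    by_contra h
    simpa using (hI x).1 hx 0 (mem_support_iff.2 h)
  have hdim :
      ringKrullDim (MvPolynomial V k ⧸ I) ≤ ((Fintype.card V - A.card : ℕ) : WithBot ℕ∞) := by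
    refine ringKrullDim_quotient_le_of_forall_isPrime _ _ fun p hp hIp => ?_
    have h1 : ∀ a ∈ A, (X a : MvPolynomial V k) ∈ p ∨ (X (σ a) : MvPolynomial V k) ∈ p := by
      intro a ha
      have h2 : (X a * X (σ a) : MvPolynomial V k) ^ 2 ∈ I := by
        rw [hI]
        intro m hm
        rw [X, X, monomial_mul, monomial_pow] at hm
        rw [Finset.mem_singleton.1 (support_monomial_subset hm)]
        refine le_trans ?_ (Finset.single_le_sum (fun _ _ => Nat.zero_le _) ha)
        simp [Finsupp.single_apply]
      exact hp.mem_or_mem (hp.mem_of_pow_mem 2 (hIp h2))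
    classical
    let g : V → V := fun a => if (X a : MvPolynomial V k) ∈ p then a else σ a
    have hg : ∀ a ∈ A, (X (g a) : MvPolynomial V k) ∈ p := by
      intro a ha
      by_cases h : (X a : MvPolynomial V k) ∈ p
      · simp [g, h]
      · simpa [g, h] using (h1 a ha).resolve_left h
    have hginj : Set.InjOn g A := by
      intro a ha b hb hab
      simp only [g] at hab
      split_ifs at hab
      · exact hab
      · exact absurd (hab ▸ ha) (hσA b hb)
      · exact absurd (hab ▸ hb) (hσA a ha)
      · exact hσ ha hb hab
    have hle : facePrime k (A.image g)ᶜ ≤ p := by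
      refine Ideal.span_le.2 ?_
      rintro _ ⟨j, hj, rfl⟩
      have hj' : j ∈ A.image g := by simpa using hj
      obtain ⟨a, ha, rfl⟩ := Finset.mem_image.1 hj'
      exact hg a ha
    refine (ringKrullDim_le_of_surjective (Ideal.Quotient.factor hle)
      (Ideal.Quotient.factor_surjective hle)).trans ?_
    refine (ringKrullDim_quotient_facePrime_le _).trans ?_
    rw [Finset.card_compl, Finset.card_image_of_injOn hginj]
  have : Module.Finite (MvPolynomial V k)
      (ModuleCat.of (MvPolynomial V k) (MvPolynomial V k ⧸ I)) :=
    inferInstanceAs (Module.Finite (MvPolynomial V k) (MvPolynomial V k ⧸ I))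
  have hA := Finset.card_le_univ A
  have hext : ExtVanishesBelow (Fintype.card V - A.card) I := by
    rw [hI']
    exact extVanishesBelow_edgeSqSet hσA hσ A ∅ le_rfl (by simp) (by simp) _
      (by simp only [Finset.card_empty]; omega)
  intro i hi
  refine (subsingleton_localCohomology_iff (Fintype.card V - A.card)
    (maxIdeal_smul_top_lt hmax)).2 hext i ?_
  have h2 := hi.trans_le hdim
  change ((i : ℕ) : WithBot ℕ∞) < ((Fintype.card V - A.card : ℕ) : WithBot ℕ∞) at h2
  exact_mod_cast h2

end Dimension

section Matching
variable {k : Type} [Field k] {V : Type} [Fintype V] [DecidableEq V]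

omit [Fintype V] in
lemma mem_facets_indepComplex_iff {G : SimpleGraph V} {σ : V → V}
    (hσ : ∀ v w, G.Adj v w ↔ w = σ v) {F : Finset V} :
    F ∈ facets (indepComplex G) ↔ ∀ v, v ∈ F ↔ σ v ∉ F := by
  have hadj : ∀ v, G.Adj v (σ v) := fun v => (hσ v _).2 rfl
  constructor
  · refine fun hF v => ⟨fun hv h => hF.1 v hv _ h (hadj v), fun h => ?_⟩
    have h1 : insert v F ∈ indepComplex G := by
      intro i hi j hj hij
      rw [Finset.mem_insert] at hi hj
      rcases hi with rfl | hi <;> rcases hj with rfl | hj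
      · exact G.irrefl hij
      · exact h ((hσ _ _).1 hij ▸ hj)
      · exact h ((hσ _ _).1 hij.symm ▸ hi)
      · exact hF.1 i hi j hj hij
    rw [hF.2 _ h1 (Finset.subset_insert _ _)]
    exact Finset.mem_insert_self _ _
  · intro h
    refine ⟨fun i hi j hj hij => (h i).1 hi ((hσ _ _).1 hij ▸ hj),
      fun H hH hle => hle.antisymm fun i hi => (h i).2 fun hi' => hH i hi _ (hle hi') (hadj i)⟩

lemma mem_symbolicPower_two_iff {G : SimpleGraph V} {σ : V → V}
    (hσ : ∀ v w, G.Adj v w ↔ w = σ v) {A : Finset V} (hA : ∀ v, v ∈ A ↔ σ v ∉ A)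
    (x : MvPolynomial V k) :
    x ∈ symbolicPower k (indepComplex G) 2 ↔
      ∀ m ∈ x.support, 2 ≤ ∑ a ∈ A, min (m a) (m (σ a)) := by
  have hσσ : ∀ v, σ (σ v) = v := fun v => ((hσ _ _).1 ((hσ v _).2 rfl).symm).symm
  have hsum : ∀ F ∈ facets (indepComplex G), ∀ m : V →₀ ℕ,
      outDegree F m = ∑ a ∈ A, m (if a ∈ F then σ a else a) := by
    intro F hF m
    rw [mem_facets_indepComplex_iff hσ] at hF
    have himage : Fᶜ = A.image fun a => if a ∈ F then σ a else a := by
      ext v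
      simp only [Finset.mem_compl, Finset.mem_image]
      constructor
      · intro hv
        by_cases hvA : v ∈ A
        · exact ⟨v, hvA, if_neg hv⟩
        · refine ⟨σ v, by_contra fun h => hvA ((hA v).2 h), ?_⟩
          rw [if_pos (by_contra fun h => hv ((hF v).2 h)), hσσ]
      · rintro ⟨a, -, rfl⟩
        split_ifs with h
        · exact (hF a).1 h
        · exact h
    rw [outDegree, himage, Finset.sum_image]
    intro a ha b hb hab
    simp only at hab
    split_ifs at hab
    · rw [← hσσ a, hab, hσσ]
    · exact absurd (hab ▸ hb) ((hA a).1 ha)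
    · exact absurd (hab ▸ ha) ((hA b).1 hb)
    · exact hab
  simp only [mem_symbolicPower, mem_facePrime_sq]
  refine ⟨fun h m hm => ?_, fun h F hF m hm => (h m hm).trans ?_⟩
  · let F : Finset V := Finset.univ.filter fun v =>
      (v ∈ A ∧ m (σ v) ≤ m v) ∨ (v ∉ A ∧ m (σ v) < m v)
    have hF : F ∈ facets (indepComplex G) := by
      rw [mem_facets_indepComplex_iff hσ]
      intro v
      have := hA v
      simp only [F, Finset.mem_filter, Finset.mem_univ, true_and, hσσ]
      by_cases hv : v ∈ A
      · have hv' := this.1 hv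
        simp [hv, hv']
      · have hv' : σ v ∈ A := by_contra fun h => hv (this.2 h)
        simp [hv, hv']
    refine (h F hF m hm).trans ((hsum F hF m).trans_le (Finset.sum_le_sum fun a ha => ?_))
    have haF : a ∈ F ↔ m (σ a) ≤ m a := by simp [F, ha]
    split_ifs with h1
    · exact le_min (haF.1 h1) le_rfl
    · exact le_min le_rfl (not_le.1 fun h => h1 (haF.2 h)).le
  · rw [hsum F hF m]
    refine Finset.sum_le_sum fun a _ => ?_
    split_ifs
    · exact min_le_right _ _
    · exact min_le_left _ _

end Matching

/-- **Proposition 4.2.** For a bipartite graph `G` (without isolated vertices),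
`S/I(G)^{(2)}` is Cohen–Macaulay if and only if `G` is a disjoint union of edges
(i.e. a perfect matching). -/
theorem bipartite_second_symbolic_power_CM_iff {n : ℕ} (k : Type) [Field k]
    (G : SimpleGraph (Fin n)) (hbip : G.Colorable 2) (hiso : noIsolated G) :
    quotCM k (Fin n) (symbolicPower k (indepComplex G) 2) ↔
      (∀ v : Fin n, ∃! w : Fin n, G.Adj v w) := by
  obtain ⟨C⟩ := hbip
  refine ⟨fun h => existsUnique_adj_of_color C hiso
    (fun F hF F' hF' => facets_card_le h hF hF') (fun H hH => exists_facet hH)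
    (fun p q hpq => exists_adjacent_facets h hpq), fun h => ?_⟩
  choose σ hσ hσ' using h
  have hadj : ∀ v w, G.Adj v w ↔ w = σ v := fun v w => ⟨hσ' v w, fun h => h ▸ hσ v⟩
  have hσσ : ∀ v, σ (σ v) = v := fun v => (hσ' _ _ (hσ v).symm).symm
  let A : Finset (Fin n) := Finset.univ.filter fun v => C v = 0
  have hA : ∀ v, v ∈ A ↔ σ v ∉ A := by
    intro v
    have := C.valid (hσ v)
    simp only [A, Finset.mem_filter, Finset.mem_univ, true_and]
    omega
  exact quotCM_of_forall_mem_iff (fun a ha => (hA a).1 ha)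
    (fun a _ b _ hab => by rw [← hσσ a, hab, hσσ]) (mem_symbolicPower_two_iff hadj hA)
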